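/- Under the standing assumptions (fixed 0<ε<1/4, n^{1/2−o(1)} < k < sqrt((1/4−ε)·n·log n), Λ(Δ) < o(1) a.s., and φ ≤ φ*): suppose A_1,…,A_γ are drawn uniformly and independently from the k-subsets of [n], and let Q be the event that {A_1,…,A_γ} is a clique with at most one vertex of degree greater than λ and no vertex of degree greater than or equal to τ. Then for any m with |m − μ̄| < √μ̄·log n, Pr(Q) = o(C(m,γ)^{−1}). -/

import Mathlib

open Filter

noncomputable section

/-- The collection of all `k`-element subsets of `Fin n`. -/
def kSets (n k : ℕ) : Finset (Finset (Fin n)) := Finset.powersetCard k Finset.univ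

open Classical in
/-- The probability that the random hypergraph `H_k(n,p)` (each `k`-subset of `[n]`
present independently with probability `p`) satisfies the property `P`. -/
def hprob (n k : ℕ) (p : ℝ) (P : Finset (Finset (Fin n)) → Prop) : ℝ :=
  ∑ H ∈ (kSets n k).powerset,
    if P H then p ^ H.card * (1 - p) ^ ((kSets n k).card - H.card) else 0

/-- A family of sets is intersecting (a clique) if no two of its members are disjoint. -/
def IsClique {n : ℕ} (C : Finset (Finset (Fin n))) : Prop :=
  ∀ A ∈ C, ∀ B ∈ C, (A ∩ B).Nonempty

/-- The star of `x` in `H`: the set of edges of `H` containing `x`. -/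
def starOf {n : ℕ} (H : Finset (Finset (Fin n))) (x : Fin n) : Finset (Finset (Fin n)) :=
  H.filter (fun A => x ∈ A)

/-- The degree of `x` in `H`. -/
def vdeg {n : ℕ} (H : Finset (Finset (Fin n))) (x : Fin n) : ℕ := (starOf H x).card

/-- The maximum degree of `H`. -/
def maxDegree {n : ℕ} (H : Finset (Finset (Fin n))) : ℕ :=
  Finset.univ.sup (vdeg H)

/-- A family is nontrivial if it is not contained in a star. -/
def IsNontrivial {n : ℕ} (C : Finset (Finset (Fin n))) : Prop :=
  ¬ ∃ x : Fin n, ∀ A ∈ C, x ∈ A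

/-- `H` satisfies (strong) EKR if every maximum-size intersecting subfamily of `H`
is a star of `H`. -/
def EKR {n : ℕ} (H : Finset (Finset (Fin n))) : Prop :=
  ∀ C ⊆ H, IsClique C → (∀ D ⊆ H, IsClique D → D.card ≤ C.card) →
    ∃ x : Fin n, C = starOf H x

open Classical in
/-- `q = q(n,k)`: the probability that two independent uniform `k`-subsets of `[n]` meet. -/
def interProb (n k : ℕ) : ℝ :=
  ((((kSets n k) ×ˢ (kSets n k)).filter fun AB => (AB.1 ∩ AB.2).Nonempty).card : ℝ) /
    ((kSets n k).card : ℝ) ^ 2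

/-- `φ = p·C(n-1,k-1)`, the expected degree of a vertex. -/
def phi (n k : ℕ) (p : ℝ) : ℝ := p * ((n - 1).choose (k - 1) : ℝ)

/-- `μ̄ = φ·n/k`, the expected number of edges. -/
def mubar (n k : ℕ) (p : ℝ) : ℝ := phi n k p * n / k

/-- The generalized binomial coefficient `C(x,t) = x(x-1)⋯(x-t+1)/t!`. -/
def gchoose (x : ℝ) (t : ℕ) : ℝ := (∏ i ∈ Finset.range t, (x - i)) / (t.factorial : ℝ)

/-- `Λ(t) = C(μ̄,t)·q^{C(t,2)}`. -/
def Lam (n k : ℕ) (p : ℝ) (t : ℕ) : ℝ :=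
  gchoose (mubar n k p) t * interProb n k ^ t.choose 2

/-- `Λ'(t)`: equals `0` for `t ≤ 2` and `Λ(t)` otherwise. -/
def Lam' (n k : ℕ) (p : ℝ) (t : ℕ) : ℝ := if t ≤ 2 then 0 else Lam n k p t

open Classical in
/-- The probability of `E` for a uniform sample from the finite set `s`. -/
def uprob {α : Type*} (s : Finset α) (E : α → Prop) : ℝ :=
  ((s.filter E).card : ℝ) / (s.card : ℝ)

open Classical in
/-- The probability of `E` under the probability mass function `w` on `Ω`. -/
def wprob {Ω : Type*} [Fintype Ω] (w : Ω → ℝ) (E : Ω → Prop) : ℝ :=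
  ∑ ω ∈ Finset.univ.filter E, w ω

open Classical in
/-- The probability that the family `{A_1,…,A_m}` formed by `m` independent uniform
`k`-subsets of `[n]` satisfies `P`. -/
def iidprob (n k m : ℕ) (P : Finset (Finset (Fin n)) → Prop) : ℝ :=
  uprob ((Finset.univ : Finset (Fin m → Finset (Fin n))).filter fun f => ∀ i, f i ∈ kSets n k)
    (fun f => P (Finset.image f Finset.univ))

open Classical in
/-- The probability that the tuple `(A_1,…,A_m)` of independent uniform `k`-subsets of `[n]`
satisfies `P`. -/
def tupleProb (n k m : ℕ) (P : (Fin m → Finset (Fin n)) → Prop) : ℝ :=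
  uprob ((Finset.univ : Finset (Fin m → Finset (Fin n))).filter fun f => ∀ i, f i ∈ kSets n k) P

/-- `Pr(Bin(M,p) ≥ θ)`. -/
def binomProbGe (M : ℕ) (p : ℝ) (θ : ℕ) : ℝ :=
  ∑ j ∈ Finset.Icc θ M, (M.choose j : ℝ) * p ^ j * (1 - p) ^ (M - j)

/-- `φ* = log³ n / log(1/q)`. -/
def phiStar (n k : ℕ) : ℝ := (Real.log n) ^ 3 / Real.log (1 / interProb n k)

/-- `α₁`: the largest integer `t` with `Pr(Bin(C(n-1,k-1),p) ≥ t) ≥ ψ/n`, where `ψ = log n`. -/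
def alpha1 (n k : ℕ) (p : ℝ) : ℕ :=
  sSup {t : ℕ | Real.log n / n ≤ binomProbGe ((n - 1).choose (k - 1)) p t}

/-- `α₂ = min{t : Λ(t) ≤ σ}`. -/
def alpha2 (n k : ℕ) (p σn : ℝ) : ℕ := sInf {t : ℕ | Lam n k p t ≤ σn}

/-- `α = max{α₁, α₂}`. -/
def alphaP (n k : ℕ) (p σn : ℝ) : ℕ := max (alpha1 n k p) (alpha2 n k p σn)

/-- `γ = min{α, φ*/3}`. -/
def gammaP (n k : ℕ) (p σn : ℝ) : ℕ := min (alphaP n k p σn) ⌊phiStar n k / 3⌋₊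

/-- `τ = (1-ε)·γ`. -/
def tauP (ε : ℝ) (n k : ℕ) (p σn : ℝ) : ℝ := (1 - ε) * (gammaP n k p σn : ℝ)

/-- `λ = max{√(log n)/log(1/q), 2·√(log n/log(1/q))}`. -/
def lamP (n k : ℕ) : ℝ :=
  max (Real.sqrt (Real.log n) / Real.log (1 / interProb n k))
    (2 * Real.sqrt (Real.log n / Real.log (1 / interProb n k)))

/-- `w̄ = max{φ²k²/n, 6 log n}`. -/
def wbar (n k : ℕ) (p : ℝ) : ℝ := max (phi n k p ^ 2 * (k : ℝ) ^ 2 / n) (6 * Real.log n)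

/-- `q̄ = (1 + 2k²w̄/(q n²))·q`. -/
def qbar (n k : ℕ) (p : ℝ) : ℝ :=
  (1 + 2 * (k : ℝ) ^ 2 * wbar n k p / (interProb n k * (n : ℝ) ^ 2)) * interProb n k

open Classical in
/-- The probability that the random subset of `H`, keeping each element independently
with probability `ρ`, satisfies `P`. -/
def sprob {β : Type*} [DecidableEq β] (H : Finset β) (ρ : ℝ) (P : Finset β → Prop) : ℝ :=
  ∑ G ∈ H.powerset, if P G then ρ ^ G.card * (1 - ρ) ^ (H.card - G.card) else 0

/-- The degree of `v` in the multiset `{f 0, …, f (m-1)}` (with multiplicity). -/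
def tdeg {n m : ℕ} (f : Fin m → Finset (Fin n)) (v : Fin n) : ℕ :=
  (Finset.univ.filter fun i => v ∈ f i).card

/-- An increasing (up-)event in `{0,1}^ι`. -/
def IncrEvent {ι : Type*} (A : Set (ι → Bool)) : Prop :=
  ∀ x y : ι → Bool, y ≤ x → y ∈ A → x ∈ A

/-- The coordinate `i` affects the event `A`. -/
def Affects {ι : Type*} (i : ι) (A : Set (ι → Bool)) : Prop :=
  ∃ η ∈ A, ∃ ν, ν ∉ A ∧ ∀ j, j ≠ i → η j = ν j

/-- Negative association of a family of `{0,1}`-valued random variables, defined on the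
finite probability space `Ω` with probability mass function `w`. -/
def NegAssoc {Ω ι : Type*} [Fintype Ω] (w : Ω → ℝ) (X : ι → Ω → Bool) : Prop :=
  ∀ A B : Set (ι → Bool), IncrEvent A → IncrEvent B →
    (∀ i, ¬ (Affects i A ∧ Affects i B)) →
    wprob w (fun ω => (fun i => X i ω) ∈ A ∧ (fun i => X i ω) ∈ B) ≤
      wprob w (fun ω => (fun i => X i ω) ∈ A) * wprob w (fun ω => (fun i => X i ω) ∈ B)

/-- `X = X_1 + ⋯ + X_m` for `{0,1}`-valued random variables. -/
def bcount {Ω : Type*} {m : ℕ} (X : Fin m → Ω → Bool) (ω : Ω) : ℕ :=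
  (Finset.univ.filter fun i => X i ω = true).card

end

lemma choose_ratio_aux (y : ℕ) : ∀ (n k : ℕ), k ≤ n → y ≤ k →
    ((n - y).choose (k - y) : ℝ) ≤ (n.choose k : ℝ) * ((k : ℝ) / n) ^ y := by
  induction y with
  | zero => intro n k _ _; simp
  | succ y ih =>
    intro n k hkn hyk
    obtain ⟨k, rfl⟩ : ∃ k', k = k' + 1 := ⟨k - 1, by omega⟩
    obtain ⟨n, rfl⟩ : ∃ n', n = n' + 1 := ⟨n - 1, by omega⟩
    have h1 := ih n k (by omega) (by omega)
    have h2 : (n + 1 - (y + 1)) = n - y := by omega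
    have h3 : (k + 1 - (y + 1)) = k - y := by omega
    rw [h2, h3]
    have h4 : ((n.choose k : ℕ) : ℝ) = ((n + 1).choose (k + 1) : ℝ) * (((k + 1 : ℕ) : ℝ) / ((n + 1 : ℕ) : ℝ)) := by
      have := Nat.add_one_mul_choose_eq n k
      have h5 : ((n : ℝ) + 1) * (n.choose k : ℝ) = ((n + 1).choose (k + 1) : ℝ) * ((k : ℝ) + 1) := by
        exact_mod_cast this
      push_cast
      field_simp
      linarith
    have h6 : ((k : ℝ) / n) ≤ (((k + 1 : ℕ) : ℝ) / ((n + 1 : ℕ) : ℝ)) := by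
      rcases Nat.eq_zero_or_pos n with h | h
      · subst h; simp; positivity
      · have hkn' : (k : ℝ) ≤ n := by exact_mod_cast (by omega : k ≤ n)
        have : (0 : ℝ) < n := by exact_mod_cast h
        push_cast
        rw [div_le_div_iff₀ this (by positivity)]
        nlinarith
    calc _ ≤ _ := h1
      _ ≤ (n.choose k : ℝ) * (((k + 1 : ℕ) : ℝ) / ((n + 1 : ℕ) : ℝ)) ^ y := by gcongr
      _ = _ := by rw [h4, pow_succ]; ring

/-- Number of `k`-sets containing a given set. -/
lemma card_superset_le (n k : ℕ) (hk : k ≤ n) (Y : Finset (Fin n)) :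
    (((kSets n k).filter fun A => Y ⊆ A).card : ℝ) ≤
      (n.choose k : ℝ) * ((k : ℝ) / n) ^ Y.card := by
  by_cases hY : Y.card ≤ k
  · unfold kSets
    rw [Finset.card_filter_powersetCard_subset _ _ _ (Finset.subset_univ Y) hY]
    simpa using choose_ratio_aux Y.card n k hk hY
  · have : ((kSets n k).filter fun A => Y ⊆ A) = ∅ := by
      apply Finset.filter_eq_empty_iff.2
      intro A hA hYA
      have h1 := Finset.card_le_card hYA
      have h2 : A.card = k := by simpa [kSets] using hA
      omega
    rw [this]
    simp
    positivity

lemma mgf_bound (n k : ℕ) (hk : k ≤ n) (R U : Finset (Fin n)) (hRU : Disjoint R U)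
    (y : Fin n → ℝ) (hy : ∀ v, 0 ≤ y v) :
    ∑ A ∈ (kSets n k).filter (fun A => R ⊆ A), ∏ v ∈ A ∩ U, (1 + y v) ≤
      (n.choose k : ℝ) * ((k : ℝ) / n) ^ R.card * ∏ v ∈ U, (1 + (k : ℝ) / n * y v) := by
  have h1 : ∀ A : Finset (Fin n), ∏ v ∈ A ∩ U, (1 + y v) =
      ∑ Z ∈ U.powerset, if Z ⊆ A then ∏ v ∈ Z, y v else 0 := by
    intro A
    rw [Finset.prod_one_add, ← Finset.sum_filter]
    apply Finset.sum_congr _ (fun _ _ => rfl)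
    ext Z
    rw [Finset.mem_powerset, Finset.mem_filter, Finset.mem_powerset, Finset.subset_inter_iff, and_comm]
  simp_rw [h1]
  rw [Finset.sum_comm, Finset.prod_one_add, Finset.mul_sum]
  apply Finset.sum_le_sum
  intro Z hZ
  rw [← Finset.sum_filter, Finset.sum_const, nsmul_eq_mul, Finset.filter_filter]
  have h2 : ((kSets n k).filter fun A => R ⊆ A ∧ Z ⊆ A) = (kSets n k).filter fun A => R ∪ Z ⊆ A := by
    apply Finset.filter_congr
    intro A _
    rw [Finset.union_subset_iff]
  rw [h2, Finset.prod_mul_distrib, Finset.prod_const]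
  have h3 := card_superset_le n k hk (R ∪ Z)
  have h4 : (R ∪ Z).card = R.card + Z.card :=
    Finset.card_union_of_disjoint (hRU.mono_right (Finset.mem_powerset.1 hZ))
  rw [h4, pow_add] at h3
  have h5 : 0 ≤ ∏ v ∈ Z, y v := Finset.prod_nonneg fun v _ => hy v
  calc _ ≤ ((n.choose k : ℝ) * (((k : ℝ) / n) ^ R.card * ((k : ℝ) / n) ^ Z.card)) * ∏ v ∈ Z, y v := by gcongr
    _ = _ := by ring

/-- local LYM for up-sets -/
lemma upset_density {α : Type*} [DecidableEq α] (G : Finset α) (E : Finset α → Prop) [DecidablePred E]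
    (hE : ∀ A B, A ⊆ B → E A → E B) (r : ℕ) (_hr : r + 1 ≤ G.card) :
    (((G.powersetCard r).filter E).card : ℝ) * (G.card.choose (r+1) : ℝ) ≤
    (((G.powersetCard (r+1)).filter E).card : ℝ) * (G.card.choose r : ℝ) := by
  have h1 : ((G.powersetCard r).filter E).card * (G.card - r) ≤
      ((G.powersetCard (r+1)).filter E).card * (r + 1) := by
    apply Finset.card_mul_le_card_mul (fun A B => A ⊆ B)
    · intro A hA
      simp only [Finset.mem_filter, Finset.mem_powersetCard] at hA
      rw [← hA.1.2, ← Finset.card_sdiff_of_subset hA.1.1]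
      apply Finset.card_le_card_of_injOn (fun x => insert x A)
      · intro x hx
        simp only [Finset.coe_sdiff, Set.mem_sdiff, Finset.mem_coe] at hx
        simp only [Finset.bipartiteAbove, Finset.coe_filter, Finset.mem_filter, Finset.mem_powersetCard, Set.mem_ofPred_eq]
        refine ⟨⟨⟨Finset.insert_subset hx.1 hA.1.1, ?_⟩, hE _ _ (Finset.subset_insert _ _) hA.2⟩, Finset.subset_insert _ _⟩
        rw [Finset.card_insert_of_notMem hx.2]
      · intro x hx y hy hxy
        simp only [Finset.coe_sdiff, Set.mem_sdiff, Finset.mem_coe] at hx hy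
        simp only at hxy
        have : x ∈ insert y A := hxy ▸ Finset.mem_insert_self x A
        rcases Finset.mem_insert.1 this with h | h
        · exact h
        · exact absurd h hx.2
    · intro B hB
      simp only [Finset.mem_filter, Finset.mem_powersetCard] at hB
      calc _ ≤ (B.powersetCard r).card := by
            apply Finset.card_le_card
            intro A hA
            simp only [Finset.bipartiteBelow, Finset.mem_filter, Finset.mem_powersetCard] at hA ⊢
            exact ⟨hA.2, hA.1.1.2⟩
        _ = r + 1 := by rw [Finset.card_powersetCard, hB.1.2]; simp
  have h2 := Nat.choose_succ_right_eq G.card r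
  have h1' : (((G.powersetCard r).filter E).card : ℝ) * ((G.card - r : ℕ) : ℝ) ≤
      (((G.powersetCard (r+1)).filter E).card : ℝ) * ((r + 1 : ℕ) : ℝ) := by exact_mod_cast h1
  have h2' : (G.card.choose (r+1) : ℝ) * ((r + 1 : ℕ) : ℝ) = (G.card.choose r : ℝ) * ((G.card - r : ℕ) : ℝ) := by
    exact_mod_cast h2
  have hpos : (0 : ℝ) < ((r + 1 : ℕ) : ℝ) := by positivity
  apply le_of_mul_le_mul_right _ hpos
  calc _ = (G.card.choose r : ℝ) * ((((G.powersetCard r).filter E).card : ℝ) * ((G.card - r : ℕ) : ℝ)) := by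
        rw [mul_assoc, h2']; ring
    _ ≤ (G.card.choose r : ℝ) * ((((G.powersetCard (r+1)).filter E).card : ℝ) * ((r + 1 : ℕ) : ℝ)) := by gcongr
    _ = _ := by ring

/-- Removing a vertex irrelevant to an up-set raises the density. -/
lemma density_erase {α : Type*} [DecidableEq α] (V : Finset α) (b : α) (hb : b ∈ V)
    (E : Finset α → Prop) [DecidablePred E]
    (hE : ∀ A B, A ⊆ B → E A → E B) (hEb : ∀ A, E (insert b A) → E A) (r : ℕ) :
    (((V.powersetCard r).filter E).card : ℝ) * ((V.erase b).card.choose r : ℝ) ≤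
    ((((V.erase b).powersetCard r).filter E).card : ℝ) * (V.card.choose r : ℝ) := by
  obtain ⟨G, hbG, rfl⟩ : ∃ G, b ∉ G ∧ V = insert b G :=
    ⟨V.erase b, Finset.notMem_erase _ _, (Finset.insert_erase hb).symm⟩
  rw [Finset.erase_insert hbG, Finset.card_insert_of_notMem hbG]
  cases r with
  | zero => simp
  | succ r =>
    have hc : (((insert b G).powersetCard (r+1)).filter E).card ≤
        ((G.powersetCard (r+1)).filter E).card + ((G.powersetCard r).filter E).card := by
      rw [Finset.powersetCard_succ_insert hbG, Finset.filter_union]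
      refine (Finset.card_union_le _ _).trans ?_
      apply Nat.add_le_add_left
      rw [Finset.filter_image]
      refine Finset.card_image_le.trans ?_
      apply Finset.card_le_card
      intro A hA
      simp only [Finset.mem_filter] at hA ⊢
      exact ⟨hA.1, hEb _ hA.2⟩
    have hc' : ((((insert b G).powersetCard (r+1)).filter E).card : ℝ) ≤
        (((G.powersetCard (r+1)).filter E).card : ℝ) + (((G.powersetCard r).filter E).card : ℝ) := by
      exact_mod_cast hc
    rw [Nat.choose_succ_succ]
    push_cast
    by_cases hr : r + 1 ≤ G.card
    · have := upset_density G E hE r hr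
      nlinarith [hc', this, Nat.cast_nonneg (α := ℝ) (G.card.choose (r+1))]
    · rw [Nat.choose_eq_zero_of_lt (by omega : G.card < r + 1)]
      simp only [Nat.cast_zero, mul_zero, add_zero]
      positivity

lemma density_sdiff {α : Type*} [DecidableEq α] (B : Finset α) (E : Finset α → Prop) [DecidablePred E]
    (hE : ∀ A B, A ⊆ B → E A → E B) (hEb : ∀ b ∈ B, ∀ A, E (insert b A) → E A) (r : ℕ) (V : Finset α) (hBV : B ⊆ V)
    (hr : r + B.card ≤ V.card) :
    (((V.powersetCard r).filter E).card : ℝ) * ((V \ B).card.choose r : ℝ) ≤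
    ((((V \ B).powersetCard r).filter E).card : ℝ) * (V.card.choose r : ℝ) := by
  induction B using Finset.induction_on with
  | empty => simp
  | insert b B hb ih =>
    have hcard := Finset.card_insert_of_notMem hb
    have h1 := ih (fun c hc => hEb c (Finset.mem_insert_of_mem hc))
      ((Finset.subset_insert _ _).trans hBV) (by omega)
    have hbV : b ∈ V \ B := by
      simp only [Finset.mem_sdiff]; exact ⟨hBV (Finset.mem_insert_self _ _), hb⟩
    have h2 := density_erase (V \ B) b hbV E hE (hEb b (Finset.mem_insert_self _ _)) r
    have h3 : (V \ B).erase b = V \ insert b B := by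
      ext x; simp only [Finset.mem_erase, Finset.mem_sdiff, Finset.mem_insert]; tauto
    rw [h3] at h2
    have h4 : (0 : ℝ) < ((V \ B).card.choose r : ℝ) := by
      have := Finset.card_sdiff_of_subset ((Finset.subset_insert b B).trans hBV)
      exact_mod_cast Nat.choose_pos (by omega)
    apply le_of_mul_le_mul_right _ h4
    have h5 : (0 : ℝ) ≤ ((V \ insert b B).card.choose r : ℝ) := by positivity
    have h6 : (0 : ℝ) ≤ (V.card.choose r : ℝ) := by positivity
    nlinarith [mul_le_mul_of_nonneg_right h1 h5, mul_le_mul_of_nonneg_right h2 h6]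

/-- Probability that a uniform `k`-subset of a `v`-set hits a fixed `k`-subset. -/
noncomputable def qf (v k : ℕ) : ℝ := 1 - ((v - k).choose k : ℝ) / (v.choose k : ℝ)

lemma choose_div_eq (w v r : ℕ) (hw : r ≤ w) (hv : r ≤ v) :
    (w.choose r : ℝ) / (v.choose r : ℝ) = ∏ i ∈ Finset.range r, (((w : ℝ) - i) / ((v : ℝ) - i)) := by
  have h : ∀ u : ℕ, r ≤ u → (u.choose r : ℝ) = (∏ i ∈ Finset.range r, ((u : ℝ) - i)) / r.factorial := by
    intro u hu
    rw [Nat.choose_eq_descFactorial_div_factorial, Nat.cast_div (Nat.factorial_dvd_descFactorial u r) (by positivity),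
      Nat.descFactorial_eq_prod_range]
    push_cast
    congr 1
    apply Finset.prod_congr rfl
    intro i hi
    rw [Nat.cast_sub (by have := Finset.mem_range.1 hi; omega)]
  rw [h w hw, h v hv, Finset.prod_div_distrib]
  field_simp

lemma choose_ratio_mono (v k r b : ℕ) (hr : r ≤ k) (hb : b ≤ k) (hv : 2 * k ≤ v) :
    ((v - k).choose k : ℝ) / (v.choose k : ℝ) ≤ ((v - b).choose r : ℝ) / (v.choose r : ℝ) := by
  rw [choose_div_eq _ _ _ (by omega) (by omega), choose_div_eq _ _ _ (by omega) (by omega)]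
  have hkv : (2 : ℝ) * k ≤ v := by exact_mod_cast hv
  have hbk : (b : ℝ) ≤ k := by exact_mod_cast hb
  rw [Nat.cast_sub (by omega), Nat.cast_sub (by omega)]
  have hpos : ∀ i ∈ Finset.range k, (0 : ℝ) ≤ ((v : ℝ) - k - i) / (v - i) := by
    intro i hi
    have : (i : ℝ) < k := by exact_mod_cast Finset.mem_range.1 hi
    apply div_nonneg <;> linarith
  have hone : ∀ i ∈ Finset.range k, ((v : ℝ) - k - i) / (v - i) ≤ 1 := by
    intro i hi
    have : (i : ℝ) < k := by exact_mod_cast Finset.mem_range.1 hi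
    apply div_le_one_of_le₀ <;> linarith
  calc ∏ i ∈ Finset.range k, ((v : ℝ) - k - i) / (v - i)
      ≤ ∏ i ∈ Finset.range r, ((v : ℝ) - k - i) / (v - i) := by
        exact Finset.prod_le_prod_of_subset_of_le_one (Finset.range_mono hr) hpos (fun i hi _ => hone i hi)
    _ ≤ _ := by
        apply Finset.prod_le_prod
        · intro i hi
          exact hpos i (Finset.range_mono hr hi)
        · intro i hi
          have : (i : ℝ) < k := by exact_mod_cast Finset.mem_range.1 (Finset.range_mono hr hi)
          apply div_le_div_of_nonneg_right <;> linarith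

/-- Hitting disjoint sets is negatively correlated. -/
lemma hit_disjoint {α ι : Type*} [DecidableEq α] [DecidableEq ι] (V : Finset α) (k r : ℕ) (hr : r ≤ k)
    (hV : 2 * k ≤ V.card) (B : ι → Finset α) (J : Finset ι) (hB : ∀ i ∈ J, B i ⊆ V ∧ (B i).card ≤ k)
    (hd : ∀ i ∈ J, ∀ j ∈ J, i ≠ j → Disjoint (B i) (B j)) :
    (((V.powersetCard r).filter fun A => ∀ i ∈ J, (A ∩ B i).Nonempty).card : ℝ) ≤
      (V.card.choose r : ℝ) * (qf V.card k) ^ J.card := by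
  induction J using Finset.induction_on with
  | empty => simp
  | insert j J hj ih =>
    have ih' := ih (fun i hi => hB i (Finset.mem_insert_of_mem hi))
      (fun i hi i' hi' => hd i (Finset.mem_insert_of_mem hi) i' (Finset.mem_insert_of_mem hi'))
    obtain ⟨hjV, hjk⟩ := hB j (Finset.mem_insert_self _ _)
    set E : Finset α → Prop := fun A => ∀ i ∈ J, (A ∩ B i).Nonempty with hE
    have hden := density_sdiff (B j) E
      (fun A A' hAA' h i hi => (h i hi).mono (Finset.inter_subset_inter_right hAA'))
      (fun b hb A h i hi => by
        obtain ⟨x, hx⟩ := h i hi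
        rw [Finset.mem_inter, Finset.mem_insert] at hx
        rcases hx.1 with h1 | h1
        · subst h1
          have hij : j ≠ i := fun h => hj (h ▸ hi)
          exact absurd hx.2 (Finset.disjoint_left.1 (hd j (Finset.mem_insert_self _ _) i (Finset.mem_insert_of_mem hi) hij) hb)
        · exact ⟨x, Finset.mem_inter.2 ⟨h1, hx.2⟩⟩)
      r V hjV (by omega)
    have hsplit : ((V.powersetCard r).filter fun A => ∀ i ∈ insert j J, (A ∩ B i).Nonempty).card +
        (((V \ B j).powersetCard r).filter E).card ≤ ((V.powersetCard r).filter E).card := by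
      rw [← Finset.card_union_of_disjoint]
      · apply Finset.card_le_card
        intro A hA
        rw [Finset.mem_union, Finset.mem_filter, Finset.mem_filter, Finset.mem_powersetCard, Finset.mem_powersetCard] at hA
        rw [Finset.mem_filter, Finset.mem_powersetCard]
        rcases hA with h | h
        · exact ⟨h.1, fun i hi => h.2 i (Finset.mem_insert_of_mem hi)⟩
        · exact ⟨⟨h.1.1.trans Finset.sdiff_subset, h.1.2⟩, h.2⟩
      · rw [Finset.disjoint_left]
        intro A hA hA'
        rw [Finset.mem_filter, Finset.mem_powersetCard] at hA hA'
        obtain ⟨x, hx⟩ := hA.2 j (Finset.mem_insert_self _ _)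
        rw [Finset.mem_inter] at hx
        exact (Finset.mem_sdiff.1 (hA'.1.1 hx.1)).2 hx.2
    have hsplit' : (((V.powersetCard r).filter fun A => ∀ i ∈ insert j J, (A ∩ B i).Nonempty).card : ℝ) +
        ((((V \ B j).powersetCard r).filter E).card : ℝ) ≤ (((V.powersetCard r).filter E).card : ℝ) := by
      exact_mod_cast hsplit
    have hcV : (0 : ℝ) < (V.card.choose r : ℝ) := by exact_mod_cast Nat.choose_pos (by omega)
    rw [Finset.card_sdiff_of_subset hjV] at hden
    have hq := choose_ratio_mono V.card k r (B j).card hr hjk hV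
    have hden2 : (((V.powersetCard r).filter E).card : ℝ) * (((V.card - (B j).card).choose r : ℝ) / (V.card.choose r : ℝ)) ≤
        ((((V \ B j).powersetCard r).filter E).card : ℝ) := by
      rw [← mul_div_assoc, div_le_iff₀ hcV]; exact hden
    have hden3 := (mul_le_mul_of_nonneg_left hq (Nat.cast_nonneg (α := ℝ) (((V.powersetCard r).filter E).card))).trans hden2
    have hqn : 0 ≤ qf V.card k := by
      unfold qf
      rw [sub_nonneg]
      apply div_le_one_of_le₀ _ (by positivity)
      exact_mod_cast Nat.choose_le_choose k (by omega)
    rw [Finset.card_insert_of_notMem hj, pow_succ, ← mul_assoc]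
    calc _ ≤ (((V.powersetCard r).filter E).card : ℝ) * qf V.card k := by
          unfold qf; linarith
      _ ≤ _ := by gcongr

lemma qf_nonneg (v k : ℕ) : 0 ≤ qf v k := by
  unfold qf
  rw [sub_nonneg]
  apply div_le_one_of_le₀ _ (by positivity)
  exact_mod_cast Nat.choose_le_choose k (by omega)

lemma qf_le_one (v k : ℕ) : qf v k ≤ 1 := by
  unfold qf
  have : (0 : ℝ) ≤ ((v - k).choose k : ℝ) / (v.choose k : ℝ) := by positivity
  linarith

lemma fiber_bound {ι : Type*} [DecidableEq ι] (n k : ℕ) (U W : Finset (Fin n)) (hW : W ⊆ U)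
    (hU : 2 * k ≤ n - U.card)
    (B : ι → Finset (Fin n)) (J : Finset ι) (hB : ∀ i ∈ J, (B i).card ≤ k)
    (hd : ∀ i ∈ J, ∀ j ∈ J, i ≠ j → Disjoint (B i \ U) (B j \ U)) (hq : 0 < qf (n - U.card) k) :
    (((kSets n k).filter fun A => A ∩ U = W ∧ ∀ i ∈ J, (A ∩ B i).Nonempty).card : ℝ) ≤
      (((kSets n k).filter fun A => A ∩ U = W).card : ℝ) *
       (qf (n - U.card) k ^ J.card * ∏ v ∈ W, ((qf (n - U.card) k)⁻¹) ^ (J.filter fun i => v ∈ B i).card) := by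
  set Q := qf (n - U.card) k with hQ
  by_cases hwk : W.card ≤ k
  swap
  · have : ((kSets n k).filter fun A => A ∩ U = W ∧ ∀ i ∈ J, (A ∩ B i).Nonempty) = ∅ := by
      apply Finset.filter_eq_empty_iff.2
      rintro A hA ⟨h1, -⟩
      have h2 : A.card = k := by simpa [kSets] using hA
      have := Finset.card_le_card (Finset.inter_subset_left : A ∩ U ⊆ A)
      rw [h1] at this
      omega
    rw [this]
    simp only [Finset.card_empty, Nat.cast_zero]
    positivity
  set V : Finset (Fin n) := Finset.univ \ U with hV
  have hVc : V.card = n - U.card := by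
    rw [hV, Finset.card_sdiff_of_subset (Finset.subset_univ _)]; simp
  set J' := J.filter fun i => Disjoint W (B i) with hJ'
  have h1 : (((kSets n k).filter fun A => A ∩ U = W ∧ ∀ i ∈ J, (A ∩ B i).Nonempty).card : ℝ) ≤
      (((V.powersetCard (k - W.card)).filter fun A => ∀ i ∈ J', (A ∩ (B i \ U)).Nonempty).card : ℝ) := by
    have : ((kSets n k).filter fun A => A ∩ U = W ∧ ∀ i ∈ J, (A ∩ B i).Nonempty).card ≤
      ((V.powersetCard (k - W.card)).filter fun A => ∀ i ∈ J', (A ∩ (B i \ U)).Nonempty).card := by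
      apply Finset.card_le_card_of_injOn (fun A => A \ U)
      · intro A hA
        rw [Finset.mem_coe, Finset.mem_filter] at hA
        rw [Finset.mem_coe, Finset.mem_filter, Finset.mem_powersetCard]
        obtain ⟨hA1, hA2, hA3⟩ := hA
        have h2 : A.card = k := by simpa [kSets] using hA1
        refine ⟨⟨Finset.sdiff_subset_sdiff (Finset.subset_univ _) subset_rfl, ?_⟩, ?_⟩
        · show (A \ U).card = _
          rw [← hA2, ← h2]
          have := Finset.card_sdiff_add_card_inter A U
          omega
        · intro i hi
          rw [hJ', Finset.mem_filter] at hi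
          obtain ⟨x, hx⟩ := hA3 i hi.1
          rw [Finset.mem_inter] at hx
          have hxU : x ∉ U := by
            intro hxU
            have : x ∈ W := by rw [← hA2]; exact Finset.mem_inter.2 ⟨hx.1, hxU⟩
            exact Finset.disjoint_left.1 hi.2 this hx.2
          exact ⟨x, by simp [hx.1, hx.2, hxU]⟩
      · intro A hA A' hA' h
        rw [Finset.mem_coe, Finset.mem_filter] at hA hA'
        simp only at h
        rw [← Finset.sdiff_union_inter A U, ← Finset.sdiff_union_inter A' U, h, hA.2.1, hA'.2.1]
    exact_mod_cast this
  have h2 : (((V.powersetCard (k - W.card)).card : ℕ) : ℝ) ≤ (((kSets n k).filter fun A => A ∩ U = W).card : ℝ) := by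
    have : (V.powersetCard (k - W.card)).card ≤ ((kSets n k).filter fun A => A ∩ U = W).card := by
      apply Finset.card_le_card_of_injOn (fun A => A ∪ W)
      · intro A hA
        rw [Finset.mem_coe, Finset.mem_powersetCard] at hA
        rw [Finset.mem_coe, Finset.mem_filter]
        have hdis : Disjoint A U := by
          rw [Finset.disjoint_left]; intro x hx
          have := hA.1 hx
          simp [hV] at this; exact this
        constructor
        · unfold kSets
          rw [Finset.mem_powersetCard, Finset.card_union_of_disjoint (hdis.mono_right hW)]
          exact ⟨Finset.subset_univ _, by omega⟩
        · rw [Finset.union_inter_distrib_right, Finset.disjoint_iff_inter_eq_empty.1 hdis,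
            Finset.inter_eq_left.2 hW, Finset.empty_union]
      · intro A hA A' hA' h
        rw [Finset.mem_coe, Finset.mem_powersetCard] at hA hA'
        simp only at h
        have hdis : ∀ A, A ⊆ V → Disjoint A W := by
          intro A hA
          rw [Finset.disjoint_left]; intro x hx hxW
          have := hA hx
          simp [hV] at this; exact this (hW hxW)
        rw [← Finset.union_sdiff_cancel_right (hdis A hA.1), h, Finset.union_sdiff_cancel_right (hdis A' hA'.1)]
    exact_mod_cast this
  have h3 := hit_disjoint V k (k - W.card) (by omega) (by omega) (fun i => B i \ U) J'
    (by
      intro i hi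
      rw [hJ', Finset.mem_filter] at hi
      exact ⟨Finset.sdiff_subset_sdiff (Finset.subset_univ _) subset_rfl,
        (Finset.card_le_card Finset.sdiff_subset).trans (hB i hi.1)⟩)
    (by
      intro i hi j hj hij
      rw [hJ', Finset.mem_filter] at hi hj
      exact hd i hi.1 j hj.1 hij)
  rw [hVc, ← hQ, ← hVc, ← Finset.card_powersetCard] at h3
  have h4 : J.card ≤ J'.card + ∑ v ∈ W, (J.filter fun i => v ∈ B i).card := by
    rw [← Finset.card_filter_add_card_filter_not (fun i => Disjoint W (B i)) (s := J)]
    apply Nat.add_le_add_left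
    refine le_trans (Finset.card_le_card ?_) Finset.card_biUnion_le
    intro i hi
    rw [Finset.mem_filter, Finset.disjoint_left] at hi
    push Not at hi
    obtain ⟨hi, v, hv, hvB⟩ := hi
    rw [Finset.mem_biUnion]
    exact ⟨v, hv, Finset.mem_filter.2 ⟨hi, hvB⟩⟩
  have hQ1 : Q ≤ 1 := qf_le_one _ _
  have h5 : Q ^ J'.card ≤ Q ^ J.card * ∏ v ∈ W, (Q⁻¹) ^ (J.filter fun i => v ∈ B i).card := by
    rw [Finset.prod_pow_eq_pow_sum, inv_pow, ← div_eq_mul_inv, le_div_iff₀ (by positivity), ← pow_add]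
    exact pow_le_pow_of_le_one hq.le hQ1 h4
  calc _ ≤ _ := h1
    _ ≤ _ := h3
    _ ≤ (((kSets n k).filter fun A => A ∩ U = W).card : ℝ) * Q ^ J'.card := by gcongr
    _ ≤ _ := by gcongr

lemma hit_step_core {ι : Type*} [DecidableEq ι] (n k : ℕ) (U : Finset (Fin n))
    (hU : 2 * k ≤ n - U.card)
    (B : ι → Finset (Fin n)) (J : Finset ι) (hB : ∀ i ∈ J, (B i).card ≤ k)
    (hd : ∀ i ∈ J, ∀ j ∈ J, i ≠ j → Disjoint (B i \ U) (B j \ U)) (hq : 0 < qf (n - U.card) k)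
    (P : Finset (Fin n) → Prop) [DecidablePred P] :
    (((kSets n k).filter fun A => P (A ∩ U) ∧ ∀ i ∈ J, (A ∩ B i).Nonempty).card : ℝ) ≤
      qf (n - U.card) k ^ J.card *
        ∑ A ∈ (kSets n k).filter (fun A => P (A ∩ U)),
          ∏ v ∈ A ∩ U, ((qf (n - U.card) k)⁻¹) ^ (J.filter fun i => v ∈ B i).card := by
  have hmaps : ∀ S : Finset (Finset (Fin n)), ∀ A ∈ S, A ∩ U ∈ U.powerset := fun S A _ =>
    Finset.mem_powerset.2 Finset.inter_subset_right
  rw [Finset.mul_sum]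
  rw [← Finset.sum_fiberwise_of_maps_to (hmaps ((kSets n k).filter (fun A => P (A ∩ U))))]
  rw [Finset.card_eq_sum_card_fiberwise (hmaps _)]
  push_cast
  apply Finset.sum_le_sum
  intro W hW
  rw [Finset.filter_filter, Finset.filter_filter]
  by_cases hP : P W
  · have := fiber_bound n k U W (Finset.mem_powerset.1 hW) hU B J hB hd hq
    have e1 : ((kSets n k).filter fun A => (P (A ∩ U) ∧ ∀ i ∈ J, (A ∩ B i).Nonempty) ∧ A ∩ U = W) =
        ((kSets n k).filter fun A => A ∩ U = W ∧ ∀ i ∈ J, (A ∩ B i).Nonempty) := by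
      apply Finset.filter_congr
      intro A _
      constructor
      · rintro ⟨⟨h1, h2⟩, h3⟩; exact ⟨h3, h2⟩
      · rintro ⟨h1, h2⟩; exact ⟨⟨h1 ▸ hP, h2⟩, h1⟩
    have e2 : ((kSets n k).filter fun A => P (A ∩ U) ∧ A ∩ U = W) = ((kSets n k).filter fun A => A ∩ U = W) := by
      apply Finset.filter_congr
      intro A _
      constructor
      · rintro ⟨h1, h2⟩; exact h2
      · rintro h1; exact ⟨h1 ▸ hP, h1⟩
    rw [e1, e2]
    refine this.trans (le_of_eq ?_)
    rw [← nsmul_eq_mul, ← Finset.sum_const]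
    apply Finset.sum_congr rfl
    intro A hA
    rw [(Finset.mem_filter.1 hA).2]
  · have e1 : ((kSets n k).filter fun A => (P (A ∩ U) ∧ ∀ i ∈ J, (A ∩ B i).Nonempty) ∧ A ∩ U = W) = ∅ := by
      apply Finset.filter_eq_empty_iff.2
      rintro A _ ⟨⟨h1, h2⟩, h3⟩
      exact hP (h3 ▸ h1)
    rw [e1]
    simp only [Finset.card_empty, Nat.cast_zero]
    apply Finset.sum_nonneg
    intro A _
    have := qf_nonneg (n - U.card) k
    positivity

lemma one_sub_qf (v k : ℕ) (h : 2 * k ≤ v) :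
    1 - qf v k = ∏ i ∈ Finset.range k, (((v : ℝ) - k - i) / ((v : ℝ) - i)) := by
  unfold qf
  rw [sub_sub_cancel, choose_div_eq _ _ _ (by omega) (by omega), Nat.cast_sub (by omega)]

lemma qf_compare (n k u : ℕ) (h1 : 4 * k ≤ n) (h2 : 2 * (u + k) ≤ n) :
    qf n k ≤ qf (n - u) k ∧
    qf (n - u) k ≤ qf n k + (1 - qf n k) * (4 * (k : ℝ) ^ 2 * u / (n : ℝ) ^ 2) := by
  rcases Nat.eq_zero_or_pos k with hk0 | hk0
  · subst hk0; simp [qf]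
  have e1 := one_sub_qf n k (by omega)
  have e2 := one_sub_qf (n - u) k (by omega)
  rw [Nat.cast_sub (by omega)] at e2
  have h1' : (4 : ℝ) * k ≤ n := by exact_mod_cast h1
  have h2' : (2 : ℝ) * (u + k) ≤ n := by exact_mod_cast h2
  have hk0' : (0 : ℝ) < k := by exact_mod_cast hk0
  have hn : (0 : ℝ) < n := by linarith
  have hu : (0 : ℝ) ≤ u := by positivity
  constructor
  · have : 1 - qf (n - u) k ≤ 1 - qf n k := by
      rw [e1, e2]
      apply Finset.prod_le_prod
      · intro i hi
        have : (i : ℝ) < k := by exact_mod_cast Finset.mem_range.1 hi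
        apply div_nonneg <;> linarith
      · intro i hi
        have : (i : ℝ) < k := by exact_mod_cast Finset.mem_range.1 hi
        rw [div_le_div_iff₀ (by linarith) (by linarith)]
        nlinarith
    linarith
  · set c : ℝ := 4 * k * u / (n : ℝ) ^ 2 with hc
    have hc0 : 0 ≤ c := by positivity
    have hc1 : c ≤ 1 := by
      rw [hc, div_le_one (by positivity)]
      nlinarith
    have hpos : 0 ≤ 1 - qf n k := by linarith [qf_le_one n k]
    have key : (1 - qf n k) * (1 - c) ^ k ≤ 1 - qf (n - u) k := by
      rw [e1, e2]
      have : (1 - c) ^ k = ∏ i ∈ Finset.range k, (1 - c) := by simp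
      rw [this, ← Finset.prod_mul_distrib]
      apply Finset.prod_le_prod
      · intro i hi
        have : (i : ℝ) < k := by exact_mod_cast Finset.mem_range.1 hi
        apply mul_nonneg
        · apply div_nonneg <;> linarith
        · linarith
      · intro i hi
        have hi' : (i : ℝ) < k := by exact_mod_cast Finset.mem_range.1 hi
        have hi0 : (0 : ℝ) ≤ i := by positivity
        have p1 : 0 < (n : ℝ) - i := by linarith
        have p2 : 0 < (n : ℝ) - u - i := by linarith
        have p3 : 0 < (n : ℝ) - k - i := by linarith
        have d1 : (n : ℝ) / 2 ≤ (n : ℝ) - u - i := by linarith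
        have d2 : (n : ℝ) / 2 ≤ (n : ℝ) - k - i := by linarith
        have hcc : k * u ≤ c * (((n : ℝ) - u - i) * ((n : ℝ) - k - i)) := by
          have : (n : ℝ) / 2 * (n / 2) ≤ ((n : ℝ) - u - i) * ((n : ℝ) - k - i) := by gcongr
          calc (k : ℝ) * u = c * ((n : ℝ) / 2 * (n / 2)) := by rw [hc]; field_simp; ring
            _ ≤ _ := by gcongr
        rw [div_mul_eq_mul_div, div_le_div_iff₀ p1 p2]
        nlinarith
    have bern : 1 - k * c ≤ (1 - c) ^ k := by
      have := one_add_mul_le_pow (a := -c) (by linarith) k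
      simpa [sub_eq_add_neg, mul_comm] using this
    have e3 : (4 * (k : ℝ) ^ 2 * u / (n : ℝ) ^ 2) = k * c := by rw [hc]; ring
    rw [e3]
    nlinarith [mul_le_mul_of_nonneg_left bern hpos]

lemma qf_pow_compare (n k u s : ℕ) (h1 : 4 * k ≤ n) (h2 : 2 * (u + k) ≤ n) (hq : 0 < qf n k) (hq1 : qf n k < 1) :
    qf (n - u) k ^ s ≤ qf n k ^ s *
      Real.exp (s * (4 * Real.log (1 / qf n k) * (k : ℝ) ^ 2 * u / (qf n k * (n : ℝ) ^ 2))) := by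
  obtain ⟨-, h⟩ := qf_compare n k u h1 h2
  set q := qf n k
  have ha : 1 - q ≤ Real.log (1 / q) := by
    rw [one_div, Real.log_inv]; linarith [Real.log_le_sub_one_of_pos hq]
  rw [mul_comm (s : ℝ), Real.exp_mul, Real.rpow_natCast, ← mul_pow]
  apply pow_le_pow_left₀ (qf_nonneg _ _)
  calc _ ≤ _ := h
    _ ≤ q + Real.log (1 / q) * (4 * (k : ℝ) ^ 2 * u / (n : ℝ) ^ 2) := by gcongr
    _ = q * (4 * Real.log (1 / q) * (k : ℝ) ^ 2 * u / (q * (n : ℝ) ^ 2) + 1) := by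
        field_simp
        ring
    _ ≤ _ := by
        gcongr
        exact Real.add_one_le_exp _

/-- Pair-intersection count outside `x`. -/
def XX {n s : ℕ} (x : Fin n) (f : Fin s → Finset (Fin n)) : ℕ :=
  ∑ v ∈ Finset.univ.erase x, (tdeg f v).choose 2

/-- the shared vertices together with `x`. -/
def UU {n s : ℕ} (x : Fin n) (f : Fin s → Finset (Fin n)) : Finset (Fin n) :=
  insert x (Finset.univ.filter fun v => 2 ≤ tdeg f v)

lemma UU_erase {n s : ℕ} (x : Fin n) (f : Fin s → Finset (Fin n)) :
    (UU x f).erase x = (Finset.univ.erase x).filter fun v => 2 ≤ tdeg f v := by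
  unfold UU
  ext v
  simp only [Finset.mem_erase, Finset.mem_insert, Finset.mem_filter, Finset.mem_univ, true_and]
  tauto

lemma sum_UU_le {n s : ℕ} (x : Fin n) (f : Fin s → Finset (Fin n)) :
    ∑ v ∈ (UU x f).erase x, tdeg f v ≤ 2 * XX x f := by
  rw [UU_erase, XX, Finset.mul_sum]
  calc _ ≤ ∑ v ∈ (Finset.univ.erase x).filter fun v => 2 ≤ tdeg f v, 2 * (tdeg f v).choose 2 := by
        apply Finset.sum_le_sum
        intro v hv
        have h2 := (Finset.mem_filter.1 hv).2
        obtain ⟨d, hd⟩ : ∃ d, tdeg f v = d + 2 := ⟨tdeg f v - 2, by omega⟩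
        rw [hd]
        have := Nat.triangle_succ (d + 1)
        rw [Nat.choose_two_right]
        have e : (d + 2) * (d + 2 - 1) = (d+2) * (d + 1) := by rw [show d + 2 - 1 = d + 1 by omega]
        rw [e, Nat.mul_div_cancel']
        · nlinarith
        · rw [mul_comm]; exact (Nat.even_mul_succ_self (d+1)).two_dvd
    _ ≤ _ := Finset.sum_le_sum_of_subset (Finset.filter_subset _ _)

lemma card_UU_le {n s : ℕ} (x : Fin n) (f : Fin s → Finset (Fin n)) :
    (UU x f).card ≤ XX x f + 1 := by
  have h1 : (UU x f).card = ((UU x f).erase x).card + 1 := by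
    rw [Finset.card_erase_of_mem (by simp [UU])]
    have : 0 < (UU x f).card := Finset.card_pos.2 ⟨x, by simp [UU]⟩
    omega
  have h2 := sum_UU_le x f
  have h3 : ((UU x f).erase x).card * 2 ≤ ∑ v ∈ (UU x f).erase x, tdeg f v := by
    rw [← smul_eq_mul, ← Finset.sum_const]
    apply Finset.sum_le_sum
    intro v hv
    rw [UU_erase] at hv
    exact (Finset.mem_filter.1 hv).2
  omega

lemma UU_disjoint {n s : ℕ} (x : Fin n) (f : Fin s → Finset (Fin n)) (i j : Fin s) (hij : i ≠ j) :
    Disjoint (f i \ UU x f) (f j \ UU x f) := by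
  rw [Finset.disjoint_left]
  intro v hv hv'
  rw [Finset.mem_sdiff] at hv hv'
  apply hv.2
  unfold UU
  rw [Finset.mem_insert, Finset.mem_filter]
  right
  refine ⟨Finset.mem_univ _, ?_⟩
  unfold tdeg
  have : ({i, j} : Finset (Fin s)).card = 2 := Finset.card_pair hij
  rw [← this]
  apply Finset.card_le_card
  intro l hl
  simp only [Finset.mem_insert, Finset.mem_singleton] at hl
  rcases hl with rfl | rfl
  · simp [hv.1]
  · simp [hv'.1]

/-- per-step error exponent -/
noncomputable def eE (n k g : ℕ) (T lam : ℝ) : ℝ :=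
  g * (4 * Real.log (1 / qf n k) * (k : ℝ) ^ 2 * (T + 1) / (qf n k * (n : ℝ) ^ 2)) +
    (k : ℝ) / n * (Real.log (1 / qf n k) * Real.exp (Real.log (1 / qf n k) * lam) * (2 * T))

lemma prod_bound {n s : ℕ} (k g : ℕ) (T lam : ℝ) (hsg : s ≤ g) (h1 : 4 * k ≤ n) (h2 : 2 * (T + 1 + k) ≤ n)
    (hq : 0 < qf n k) (hq1 : qf n k < 1) (x : Fin n) (f : Fin s → Finset (Fin n))
    (hX : (XX x f : ℝ) ≤ T) (hdeg : ∀ v, v ≠ x → (tdeg f v : ℝ) ≤ lam) (J : Finset (Fin s)) :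
    qf (n - (UU x f).card) k ^ J.card *
      ∏ v ∈ (UU x f).erase x, (1 + (k : ℝ) / n * (((qf (n - (UU x f).card) k)⁻¹) ^ (J.filter fun i => v ∈ f i).card - 1))
    ≤ qf n k ^ J.card * Real.exp (eE n k g T lam) := by
  have hu := card_UU_le x f
  have hu' : ((UU x f).card : ℝ) ≤ XX x f + 1 := by exact_mod_cast hu
  have hu2 : 2 * ((UU x f).card + k) ≤ n := by
    have : (2 : ℝ) * (((UU x f).card : ℝ) + k) ≤ n := by linarith
    exact_mod_cast this
  have hJs : J.card ≤ g := by
    have := Finset.card_le_univ J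
    simp at this; omega
  obtain ⟨hc, -⟩ := qf_compare n k _ h1 hu2
  have hp := qf_pow_compare n k _ J.card h1 hu2 hq hq1
  set Q := qf (n - (UU x f).card) k
  set q := qf n k with hqdef
  set a := Real.log (1 / q) with ha
  have hQ : 0 < Q := lt_of_lt_of_le hq hc
  have ha0 : 0 < a := Real.log_pos (by rw [lt_div_iff₀ hq]; linarith)
  have hT0 : 0 ≤ T := le_trans (by positivity) hX
  have hy : ∀ v ∈ (UU x f).erase x, (Q⁻¹) ^ (J.filter fun i => v ∈ f i).card - 1 ≤
      a * Real.exp (a * lam) * tdeg f v := by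
    intro v hv
    have hvx : v ≠ x := (Finset.mem_erase.1 hv).1
    have hd : (J.filter fun i => v ∈ f i).card ≤ tdeg f v :=
      Finset.card_le_card (Finset.filter_subset_filter _ (Finset.subset_univ _))
    set d := (J.filter fun i => v ∈ f i).card
    have hd' : (d : ℝ) ≤ tdeg f v := by exact_mod_cast hd
    have e1 : (Q⁻¹) ^ d ≤ (q⁻¹) ^ d := by
      apply pow_le_pow_left₀ (by positivity)
      exact inv_anti₀ hq hc
    have e2 : (q⁻¹) ^ d = Real.exp (a * d) := by
      rw [Real.exp_mul, ha, Real.exp_log (by positivity), Real.rpow_natCast, one_div]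
    have e3 : Real.exp (a * d) - 1 ≤ a * d * Real.exp (a * d) := by
      have := Real.add_one_le_exp (-(a * d))
      have h3 : Real.exp (-(a*d)) * Real.exp (a * d) = 1 := by rw [← Real.exp_add]; simp
      nlinarith [Real.exp_pos (a * d)]
    have e4 : Real.exp (a * d) ≤ Real.exp (a * lam) := by
      apply Real.exp_le_exp.2
      exact mul_le_mul_of_nonneg_left (hd'.trans (hdeg v hvx)) ha0.le
    calc _ ≤ Real.exp (a * d) - 1 := by linarith
      _ ≤ a * d * Real.exp (a * d) := e3
      _ ≤ a * tdeg f v * Real.exp (a * lam) := by gcongr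
      _ = _ := by ring
  have hprod : ∏ v ∈ (UU x f).erase x, (1 + (k : ℝ) / n * ((Q⁻¹) ^ (J.filter fun i => v ∈ f i).card - 1)) ≤
      Real.exp ((k : ℝ) / n * (a * Real.exp (a * lam) * (2 * T))) := by
    calc _ ≤ ∏ v ∈ (UU x f).erase x, Real.exp ((k : ℝ) / n * (a * Real.exp (a * lam) * tdeg f v)) := by
          apply Finset.prod_le_prod
          · intro v _
            have : 1 ≤ (Q⁻¹) ^ (J.filter fun i => v ∈ f i).card :=
              one_le_pow₀ (one_le_inv_iff₀.2 ⟨hQ, qf_le_one _ _⟩)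
            have : 0 ≤ (k : ℝ) / n * ((Q⁻¹) ^ (J.filter fun i => v ∈ f i).card - 1) :=
              mul_nonneg (by positivity) (by linarith)
            linarith
          · intro v hv
            have h3 : (k : ℝ) / n * ((Q⁻¹) ^ (J.filter fun i => v ∈ f i).card - 1) ≤
              (k : ℝ) / n * (a * Real.exp (a * lam) * tdeg f v) := by gcongr; exact hy v hv
            have := Real.add_one_le_exp ((k : ℝ) / n * (a * Real.exp (a * lam) * tdeg f v))
            linarith
      _ = Real.exp ((k : ℝ) / n * (a * Real.exp (a * lam) * ∑ v ∈ (UU x f).erase x, (tdeg f v : ℝ))) := by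
          rw [← Real.exp_sum, ← Finset.mul_sum, ← Finset.mul_sum]
      _ ≤ _ := by
          apply Real.exp_le_exp.2
          gcongr
          have := sum_UU_le x f
          have h3 : ∑ v ∈ (UU x f).erase x, (tdeg f v : ℝ) ≤ 2 * XX x f := by exact_mod_cast this
          linarith
  have hn0 : 0 < n := x.pos
  calc _ ≤ (q ^ J.card * Real.exp (J.card * (4 * a * (k : ℝ) ^ 2 * (UU x f).card / (q * (n : ℝ) ^ 2)))) *
        Real.exp ((k : ℝ) / n * (a * Real.exp (a * lam) * (2 * T))) := by
        apply mul_le_mul hp hprod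
        · apply Finset.prod_nonneg
          intro v _
          have : 1 ≤ (Q⁻¹) ^ (J.filter fun i => v ∈ f i).card :=
              one_le_pow₀ (one_le_inv_iff₀.2 ⟨hQ, qf_le_one _ _⟩)
          have : 0 ≤ (k : ℝ) / n * ((Q⁻¹) ^ (J.filter fun i => v ∈ f i).card - 1) :=
              mul_nonneg (by positivity) (by linarith)
          linarith
        · positivity
    _ = q ^ J.card * Real.exp (J.card * (4 * a * (k : ℝ) ^ 2 * (UU x f).card / (q * (n : ℝ) ^ 2)) +
        (k : ℝ) / n * (a * Real.exp (a * lam) * (2 * T))) := by rw [Real.exp_add]; ring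
    _ ≤ _ := by
        unfold eE
        rw [← hqdef, ← ha]
        have : (J.card : ℝ) ≤ g := by exact_mod_cast hJs
        have : ((UU x f).card : ℝ) ≤ T + 1 := by linarith
        gcongr

lemma step_a {n s : ℕ} (k g : ℕ) (T lam : ℝ) (hsg : s ≤ g) (h1 : 4 * k ≤ n) (h2 : 2 * (T + 1 + k) ≤ n)
    (hq : 0 < qf n k) (hq1 : qf n k < 1) (x : Fin n) (f : Fin s → Finset (Fin n)) (hf : ∀ i, f i ∈ kSets n k)
    (hX : (XX x f : ℝ) ≤ T) (hdeg : ∀ v, v ≠ x → (tdeg f v : ℝ) ≤ lam) (J : Finset (Fin s))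
    (hxJ : ∀ i ∈ J, x ∉ f i) :
    (((kSets n k).filter fun A => x ∈ A ∧ ∀ i ∈ J, (A ∩ f i).Nonempty).card : ℝ) ≤
      (n.choose k : ℝ) * ((k : ℝ) / n) * (qf n k ^ J.card * Real.exp (eE n k g T lam)) := by
  have hpb := prod_bound k g T lam hsg h1 h2 hq hq1 x f hX hdeg J
  have hu := card_UU_le x f
  have hu' : ((UU x f).card : ℝ) ≤ XX x f + 1 := by exact_mod_cast hu
  have hu2 : 2 * ((UU x f).card + k) ≤ n := by
    have : (2 : ℝ) * (((UU x f).card : ℝ) + k) ≤ n := by linarith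
    exact_mod_cast this
  obtain ⟨hc, -⟩ := qf_compare n k _ h1 hu2
  have hcore := hit_step_core n k (UU x f) (by omega) f J
    (fun i _ => by have := hf i; simp [kSets] at this; omega)
    (fun i _ j _ hij => UU_disjoint x f i j hij) (lt_of_lt_of_le hq hc) (fun W => x ∈ W)
  have hxU : x ∈ UU x f := by simp [UU]
  have e1 : ∀ A : Finset (Fin n), x ∈ A ∩ UU x f ↔ x ∈ A := by simp [hxU]
  simp only [e1] at hcore
  set Q := qf (n - (UU x f).card) k
  have hQ : 0 < Q := lt_of_lt_of_le hq hc
  have hQ1 : ∀ v, 0 ≤ (Q⁻¹) ^ (J.filter fun i => v ∈ f i).card - 1 := by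
    intro v
    have : 1 ≤ (Q⁻¹) ^ (J.filter fun i => v ∈ f i).card :=
              one_le_pow₀ (one_le_inv_iff₀.2 ⟨hQ, qf_le_one _ _⟩)
    linarith
  have hm := mgf_bound n k (by omega) {x} ((UU x f).erase x) (by simp)
    (fun v => (Q⁻¹) ^ (J.filter fun i => v ∈ f i).card - 1) hQ1
  have e2 : ∑ A ∈ (kSets n k).filter (fun A => x ∈ A),
          ∏ v ∈ A ∩ UU x f, (Q⁻¹) ^ (J.filter fun i => v ∈ f i).card ≤
      ∑ A ∈ (kSets n k).filter (fun A => {x} ⊆ A), ∏ v ∈ A ∩ (UU x f).erase x,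
        (1 + ((Q⁻¹) ^ (J.filter fun i => v ∈ f i).card - 1)) := by
    simp only [Finset.singleton_subset_iff]
    apply le_of_eq
    apply Finset.sum_congr rfl
    intro A hA
    have hxA : x ∈ A := (Finset.mem_filter.1 hA).2
    rw [Finset.inter_erase, ← Finset.mul_prod_erase (A ∩ UU x f) _ (Finset.mem_inter.2 ⟨hxA, hxU⟩)]
    have : (J.filter fun i => x ∈ f i) = ∅ := Finset.filter_eq_empty_iff.2 hxJ
    rw [this]
    simp
  calc _ ≤ _ := hcore
    _ ≤ Q ^ J.card * ((n.choose k : ℝ) * ((k : ℝ) / n) ^ ({x} : Finset (Fin n)).card *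
        ∏ v ∈ (UU x f).erase x, (1 + (k : ℝ) / n * ((Q⁻¹) ^ (J.filter fun i => v ∈ f i).card - 1))) :=
        mul_le_mul_of_nonneg_left (e2.trans hm) (by positivity)
    _ = (n.choose k : ℝ) * ((k : ℝ) / n) * (Q ^ J.card * ∏ v ∈ (UU x f).erase x, (1 + (k : ℝ) / n * ((Q⁻¹) ^ (J.filter fun i => v ∈ f i).card - 1))) := by
        simp; ring
    _ ≤ _ := by gcongr

lemma step_b {n s : ℕ} (k g : ℕ) (T lam : ℝ) (hsg : s ≤ g) (h1 : 4 * k ≤ n) (h2 : 2 * (T + 1 + k) ≤ n)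
    (hq : 0 < qf n k) (hq1 : qf n k < 1) (x : Fin n) (f : Fin s → Finset (Fin n)) (hf : ∀ i, f i ∈ kSets n k)
    (hX : (XX x f : ℝ) ≤ T) (hdeg : ∀ v, v ≠ x → (tdeg f v : ℝ) ≤ lam) (J : Finset (Fin s)) :
    (((kSets n k).filter fun A => x ∉ A ∧ ∀ i ∈ J, (A ∩ f i).Nonempty).card : ℝ) ≤
      (n.choose k : ℝ) * (qf n k ^ J.card * Real.exp (eE n k g T lam)) := by
  have hpb := prod_bound k g T lam hsg h1 h2 hq hq1 x f hX hdeg J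
  have hu := card_UU_le x f
  have hu' : ((UU x f).card : ℝ) ≤ XX x f + 1 := by exact_mod_cast hu
  have hu2 : 2 * ((UU x f).card + k) ≤ n := by
    have : (2 : ℝ) * (((UU x f).card : ℝ) + k) ≤ n := by linarith
    exact_mod_cast this
  obtain ⟨hc, -⟩ := qf_compare n k _ h1 hu2
  have hcore := hit_step_core n k (UU x f) (by omega) f J
    (fun i _ => by have := hf i; simp [kSets] at this; omega)
    (fun i _ j _ hij => UU_disjoint x f i j hij) (lt_of_lt_of_le hq hc) (fun W => x ∉ W)
  have hxU : x ∈ UU x f := by simp [UU]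
  have e1 : ∀ A : Finset (Fin n), x ∉ A ∩ UU x f ↔ x ∉ A := by simp [hxU]
  simp only [e1] at hcore
  set Q := qf (n - (UU x f).card) k
  have hQ : 0 < Q := lt_of_lt_of_le hq hc
  have hQ1 : ∀ v, 0 ≤ (Q⁻¹) ^ (J.filter fun i => v ∈ f i).card - 1 := by
    intro v
    have : 1 ≤ (Q⁻¹) ^ (J.filter fun i => v ∈ f i).card :=
              one_le_pow₀ (one_le_inv_iff₀.2 ⟨hQ, qf_le_one _ _⟩)
    linarith
  have hm := mgf_bound n k (by omega) ∅ ((UU x f).erase x) (by simp)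
    (fun v => (Q⁻¹) ^ (J.filter fun i => v ∈ f i).card - 1) hQ1
  have e2 : ∑ A ∈ (kSets n k).filter (fun A => x ∉ A),
          ∏ v ∈ A ∩ UU x f, (Q⁻¹) ^ (J.filter fun i => v ∈ f i).card ≤
      ∑ A ∈ (kSets n k).filter (fun A => ∅ ⊆ A), ∏ v ∈ A ∩ (UU x f).erase x,
        (1 + ((Q⁻¹) ^ (J.filter fun i => v ∈ f i).card - 1)) := by
    simp only [Finset.empty_subset, Finset.filter_true]
    calc _ = ∑ A ∈ (kSets n k).filter (fun A => x ∉ A), ∏ v ∈ A ∩ (UU x f).erase x,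
        (1 + ((Q⁻¹) ^ (J.filter fun i => v ∈ f i).card - 1)) := by
          apply Finset.sum_congr rfl
          intro A hA
          have hxA : x ∉ A := (Finset.mem_filter.1 hA).2
          rw [Finset.inter_erase, Finset.erase_eq_of_notMem (by simp [hxA])]
          simp
      _ ≤ _ := by
          apply Finset.sum_le_sum_of_subset_of_nonneg (Finset.filter_subset _ _)
          intro A _ _
          apply Finset.prod_nonneg
          intro v _
          linarith [hQ1 v]
  calc _ ≤ _ := hcore
    _ ≤ Q ^ J.card * ((n.choose k : ℝ) * ((k : ℝ) / n) ^ (∅ : Finset (Fin n)).card *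
        ∏ v ∈ (UU x f).erase x, (1 + (k : ℝ) / n * ((Q⁻¹) ^ (J.filter fun i => v ∈ f i).card - 1))) :=
        mul_le_mul_of_nonneg_left (e2.trans hm) (by positivity)
    _ = (n.choose k : ℝ) * (Q ^ J.card * ∏ v ∈ (UU x f).erase x, (1 + (k : ℝ) / n * ((Q⁻¹) ^ (J.filter fun i => v ∈ f i).card - 1))) := by
        simp; ring
    _ ≤ _ := by gcongr

/-- tuples of `k`-sets -/
def kTup (n k s : ℕ) : Finset (Fin s → Finset (Fin n)) := Fintype.piFinset fun _ => kSets n k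

lemma sum_snoc {n k s : ℕ} (w : (Fin (s+1) → Finset (Fin n)) → ℝ) :
    ∑ f ∈ kTup n k (s+1), w f = ∑ f ∈ kTup n k s, ∑ A ∈ kSets n k, w (Fin.snoc f A) := by
  rw [← Finset.sum_product']
  symm
  apply Finset.sum_nbij' (fun p => (Fin.snoc p.1 p.2 : Fin (s+1) → Finset (Fin n)))
    (fun f => (Fin.init f, f (Fin.last s)))
  · rintro ⟨f, A⟩ h
    simp only [Finset.mem_product, kTup, Fintype.mem_piFinset] at h ⊢
    intro i
    refine Fin.lastCases ?_ (fun j => ?_) i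
    · simpa using h.2
    · simpa using h.1 j
  · intro f h
    simp only [Finset.mem_product, kTup, Fintype.mem_piFinset, Fin.init] at h ⊢
    exact ⟨fun i => h _, h _⟩
  · rintro ⟨f, A⟩ _
    simp
  · intro f _
    simp
  · intro p _
    rfl

lemma tdeg_snoc {n s : ℕ} (f : Fin s → Finset (Fin n)) (A : Finset (Fin n)) (v : Fin n) :
    tdeg (Fin.snoc f A : Fin (s+1) → Finset (Fin n)) v = tdeg f v + if v ∈ A then 1 else 0 := by
  unfold tdeg
  rw [Finset.card_filter, Finset.card_filter, Fin.sum_univ_castSucc]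
  simp

lemma XX_snoc {n s : ℕ} (x : Fin n) (f : Fin s → Finset (Fin n)) (A : Finset (Fin n)) :
    XX x (Fin.snoc f A : Fin (s+1) → Finset (Fin n)) = XX x f + ∑ v ∈ A ∩ Finset.univ.erase x, tdeg f v := by
  unfold XX
  have : A ∩ Finset.univ.erase x = (Finset.univ.erase x).filter (fun v => v ∈ A) := by
    ext v; simp [and_comm]
  rw [this, Finset.sum_filter, ← Finset.sum_add_distrib]
  apply Finset.sum_congr rfl
  intro v _
  rw [tdeg_snoc]
  split_ifs with h
  · rw [Nat.choose_succ_succ' _ 1]; simp [add_comm]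
  · simp

/-- The good event relative to a special vertex and a set of indices. -/
def Good {n s : ℕ} (x : Fin n) (I : Finset ℕ) (T lam : ℝ) (f : Fin s → Finset (Fin n)) : Prop :=
  (∀ i j, i ≠ j → (f i ∩ f j).Nonempty) ∧ (∀ v, v ≠ x → (tdeg f v : ℝ) ≤ lam) ∧
  ((XX x f : ℝ) ≤ T) ∧ (∀ i : Fin s, x ∈ f i ↔ (i : ℕ) ∈ I)

lemma Good_init {n s : ℕ} {x : Fin n} {I : Finset ℕ} {T lam : ℝ} {f : Fin s → Finset (Fin n)} {A : Finset (Fin n)}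
    (h : Good x I T lam (Fin.snoc f A : Fin (s+1) → Finset (Fin n))) :
    Good x I T lam f ∧ (x ∈ A ↔ s ∈ I) ∧ ∀ i, (A ∩ f i).Nonempty := by
  obtain ⟨h1, h2, h3, h4⟩ := h
  refine ⟨⟨?_, ?_, ?_, ?_⟩, ?_, ?_⟩
  · intro i j hij
    have := h1 i.castSucc j.castSucc (by simpa using hij)
    simpa using this
  · intro v hv
    have := h2 v hv
    rw [tdeg_snoc] at this
    refine le_trans ?_ this
    exact_mod_cast Nat.le_add_right _ _
  · rw [XX_snoc] at h3
    refine le_trans ?_ h3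
    exact_mod_cast Nat.le_add_right _ _
  · intro i
    simpa using h4 i.castSucc
  · simpa using h4 (Fin.last s)
  · intro i
    have := h1 (Fin.last s) i.castSucc (by simp [Fin.ext_iff]; omega)
    simpa using this

open Classical in
lemma good_count {n : ℕ} (k g : ℕ) (T lam : ℝ) (h1 : 4 * k ≤ n) (h2 : 2 * (T + 1 + k) ≤ n)
    (hq : 0 < qf n k) (hq1 : qf n k < 1) (x : Fin n) (I : Finset ℕ) (s : ℕ) (hs : s ≤ g) :
    (((kTup n k s).filter (Good x I T lam)).card : ℝ) * qf n k ^ ((I.filter (· < s)).card.choose 2) ≤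
     (n.choose k : ℝ) ^ s * ((k : ℝ) / n) ^ (I.filter (· < s)).card * qf n k ^ (s.choose 2) *
      Real.exp (eE n k g T lam) ^ s := by
  induction s with
  | zero =>
    have : ((kTup n k 0).filter (Good x I T lam)).card ≤ 1 :=
      (Finset.card_filter_le _ _).trans (by simp [kTup])
    have h' : (((kTup n k 0).filter (Good x I T lam)).card : ℝ) ≤ 1 := by exact_mod_cast this
    simpa using h'
  | succ s ih =>
    have ih' := ih (by omega)
    set q := qf n k with hqd
    set E := Real.exp (eE n k g T lam) with hE
    have hE0 : 0 < E := Real.exp_pos _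
    set N : ℝ := (n.choose k : ℝ) with hN
    set d := (I.filter (· < s)).card with hd
    have hcount : ∀ c : ℝ, (∀ f ∈ (kTup n k s).filter (Good x I T lam),
        (((kSets n k).filter fun A => (x ∈ A ↔ s ∈ I) ∧ ∀ i, (A ∩ f i).Nonempty).card : ℝ) ≤ c) →
        (((kTup n k (s+1)).filter (Good x I T lam)).card : ℝ) ≤ c * (((kTup n k s).filter (Good x I T lam)).card : ℝ) := by
      intro c hc
      rw [Finset.card_filter]
      push_cast
      rw [sum_snoc (k := k), mul_comm c, ← nsmul_eq_mul, ← Finset.sum_const, Finset.sum_filter]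
      apply Finset.sum_le_sum
      intro f hf
      split_ifs with hG
      · refine le_trans ?_ (hc f (Finset.mem_filter.2 ⟨hf, hG⟩))
        rw [Finset.card_filter]
        push_cast
        apply Finset.sum_le_sum
        intro A _
        split_ifs with h1 h2
        · exact le_rfl
        · exact absurd (Good_init h1).2 h2
        · exact zero_le_one
        · exact le_rfl
      · apply Finset.sum_nonpos
        intro A _
        rw [if_neg (fun h => hG (Good_init h).1)]
    by_cases hsI : s ∈ I
    · have hd' : (I.filter (· < s + 1)).card = d + 1 := by
        have : I.filter (· < s + 1) = insert s (I.filter (· < s)) := by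
          ext j
          simp only [Finset.mem_filter, Finset.mem_insert]
          constructor
          · rintro ⟨h, h'⟩
            by_cases hj : j = s
            · exact Or.inl hj
            · exact Or.inr ⟨h, by omega⟩
          · rintro (h | h)
            · subst h; exact ⟨hsI, by omega⟩
            · exact ⟨h.1, by omega⟩
        rw [this, Finset.card_insert_of_notMem (by simp)]
      have hc := hcount (N * ((k : ℝ) / n) * (q ^ (s - d) * E)) (by
        intro f hf
        rw [Finset.mem_filter] at hf
        obtain ⟨hf1, hG⟩ := hf
        have hf2 : ∀ i, f i ∈ kSets n k := by simpa [kTup] using hf1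
        have := step_a k g T lam (by omega) h1 h2 hq hq1 x f hf2 hG.2.2.1 hG.2.1
          (Finset.univ.filter fun i => x ∉ f i) (by simp)
        have hJ : (Finset.univ.filter fun i => x ∉ f i).card = s - d := by
          have e := Finset.card_filter_add_card_filter_not (fun i => x ∈ f i) (s := (Finset.univ : Finset (Fin s)))
          have e2 : (Finset.univ.filter fun i => x ∈ f i).card = d := by
            rw [hd]
            apply Finset.card_bij (fun (i : Fin s) _ => (i : ℕ))
            · intro i hi
              simp only [Finset.mem_filter, Finset.mem_univ, true_and] at hi ⊢
              exact ⟨(hG.2.2.2 i).1 hi, i.2⟩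
            · intro i _ j _ h
              exact Fin.ext h
            · intro j hj
              simp only [Finset.mem_filter] at hj
              exact ⟨⟨j, hj.2⟩, by simp [hG.2.2.2, hj.1], rfl⟩
          simp at e
          omega
        rw [hJ] at this
        refine le_trans ?_ this
        norm_cast
        apply Finset.card_le_card
        intro A hA
        simp only [Finset.mem_filter] at hA ⊢
        exact ⟨hA.1, hA.2.1.2 hsI, fun i _ => hA.2.2 i⟩)
      have hds : d ≤ s := by
        have : (I.filter (· < s)) ⊆ Finset.range s := by
          intro j hj
          simpa using (Finset.mem_filter.1 hj).2
        simpa using Finset.card_le_card this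
      rw [hd', Nat.choose_succ_succ' d 1, Nat.choose_succ_succ' s 1, Nat.choose_one_right, Nat.choose_one_right]
      have e3 : q ^ (s - d) * q ^ d = q ^ s := by rw [← pow_add]; congr 1; omega
      calc _ ≤ (N * ((k : ℝ) / n) * (q ^ (s - d) * E) * (((kTup n k s).filter (Good x I T lam)).card : ℝ)) * q ^ (d + d.choose 2) := by gcongr
        _ = N * ((k : ℝ) / n) * E * (q ^ (s - d) * q ^ d) * ((((kTup n k s).filter (Good x I T lam)).card : ℝ) * q ^ (d.choose 2)) := by
          rw [pow_add]; ring
        _ ≤ N * ((k : ℝ) / n) * E * (q ^ (s - d) * q ^ d) * (N ^ s * ((k : ℝ) / n) ^ d * q ^ (s.choose 2) * E ^ s) := by gcongr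
        _ = _ := by rw [e3]; ring
    · have hd' : (I.filter (· < s + 1)).card = d := by
        congr 1
        ext j
        simp only [Finset.mem_filter]
        constructor
        · rintro ⟨h, h'⟩
          exact ⟨h, lt_of_le_of_ne (by omega) (fun h2 => hsI (h2 ▸ h))⟩
        · rintro h; exact ⟨h.1, by omega⟩
      have hc := hcount (N * (q ^ s * E)) (by
        intro f hf
        rw [Finset.mem_filter] at hf
        obtain ⟨hf1, hG⟩ := hf
        have hf2 : ∀ i, f i ∈ kSets n k := by simpa [kTup] using hf1
        have := step_b k g T lam (by omega) h1 h2 hq hq1 x f hf2 hG.2.2.1 hG.2.1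
          Finset.univ
        rw [Finset.card_univ, Fintype.card_fin] at this
        refine le_trans ?_ this
        norm_cast
        apply Finset.card_le_card
        intro A hA
        simp only [Finset.mem_filter] at hA ⊢
        exact ⟨hA.1, fun h => hsI (hA.2.1.1 h), fun i _ => hA.2.2 i⟩)
      rw [hd', Nat.choose_succ_succ' s 1, Nat.choose_one_right]
      calc _ ≤ (N * (q ^ s * E) * (((kTup n k s).filter (Good x I T lam)).card : ℝ)) * q ^ (d.choose 2) := by gcongr
        _ = N * E * q ^ s * ((((kTup n k s).filter (Good x I T lam)).card : ℝ) * q ^ (d.choose 2)) := by ring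
        _ ≤ N * E * q ^ s * (N ^ s * ((k : ℝ) / n) ^ d * q ^ (s.choose 2) * E ^ s) := by gcongr
        _ = _ := by ring

lemma sum_tdeg {n k s : ℕ} (f : Fin s → Finset (Fin n)) (hf : ∀ i, f i ∈ kSets n k) :
    ∑ v, tdeg f v = s * k := by
  unfold tdeg
  simp_rw [Finset.card_filter]
  rw [Finset.sum_comm]
  have : ∀ i ∈ (Finset.univ : Finset (Fin s)), (∑ v : Fin n, if v ∈ f i then 1 else 0) = k := by
    intro i _
    have h := hf i
    rw [Finset.sum_boole]
    simp [kSets] at h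
    simpa using h
  rw [Finset.sum_congr rfl this]
  simp

open Classical in
lemma mgf_seq {n : ℕ} (k g : ℕ) (lam θ : ℝ) (hk : k ≤ n) (hθ : 0 ≤ θ) (hθl : θ * lam ≤ 1)
    (x : Fin n) (s : ℕ) (hs : s ≤ g) :
    ∑ f ∈ (kTup n k s).filter (fun f => ∀ v, v ≠ x → (tdeg f v : ℝ) ≤ lam), Real.exp (θ * XX x f) ≤
      ((n.choose k : ℝ) * Real.exp (2 * θ * (k : ℝ) ^ 2 * g / n)) ^ s := by
  induction s with
  | zero =>
    have hone : ∀ f : Fin 0 → Finset (Fin n), Real.exp (θ * XX x f) = 1 := by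
      intro f
      have : XX x f = 0 := by simp [XX, tdeg]
      simp [this]
    have h1 : ((kTup n k 0).filter (fun f => ∀ v, v ≠ x → (tdeg f v : ℝ) ≤ lam)).card ≤ 1 :=
      (Finset.card_filter_le _ _).trans (by simp [kTup])
    rw [Finset.sum_congr rfl (fun f _ => hone f)]
    simp only [Finset.sum_const, nsmul_eq_mul, mul_one, pow_zero]
    exact_mod_cast h1
  | succ s ih =>
    have ih' := ih (by omega)
    rw [Finset.sum_filter, sum_snoc]
    rw [pow_succ]
    set C := ((n.choose k : ℝ) * Real.exp (2 * θ * (k : ℝ) ^ 2 * g / n)) with hC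
    have hC0 : 0 ≤ C := by positivity
    refine le_trans ?_ (mul_le_mul_of_nonneg_right ih' hC0)
    rw [Finset.sum_mul, Finset.sum_filter]
    apply Finset.sum_le_sum
    intro f hf
    have hf2 : ∀ i, f i ∈ kSets n k := by simpa [kTup] using hf
    split_ifs with hdeg
    · have hm := mgf_bound n k hk ∅ (Finset.univ.erase x) (by simp)
        (fun v => Real.exp (θ * tdeg f v) - 1) (by
          intro v
          have : 0 ≤ θ * tdeg f v := by positivity
          have := Real.one_le_exp this
          linarith)
      simp only [Finset.empty_subset, Finset.filter_true, Finset.card_empty, pow_zero, mul_one, add_sub_cancel] at hm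
      have hp : ∏ v ∈ Finset.univ.erase x, (1 + (k : ℝ) / n * (Real.exp (θ * tdeg f v) - 1)) ≤
          Real.exp (2 * θ * (k : ℝ) ^ 2 * g / n) := by
        calc _ ≤ ∏ v ∈ Finset.univ.erase x, Real.exp ((k : ℝ) / n * (2 * θ * tdeg f v)) := by
              apply Finset.prod_le_prod
              · intro v _
                have : 0 ≤ θ * tdeg f v := by positivity
                have := Real.one_le_exp this
                have : 0 ≤ (k : ℝ) / n * (Real.exp (θ * tdeg f v) - 1) := mul_nonneg (by positivity) (by linarith)
                linarith
              · intro v hv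
                have hvx : v ≠ x := (Finset.mem_erase.1 hv).1
                have hy0 : 0 ≤ θ * tdeg f v := by positivity
                have hy1 : θ * tdeg f v ≤ 1 := le_trans (mul_le_mul_of_nonneg_left (hdeg v hvx) hθ) hθl
                have hb : Real.exp (θ * tdeg f v) - 1 ≤ 2 * θ * tdeg f v := by
                  have := Real.abs_exp_sub_one_le (x := θ * tdeg f v) (by rw [abs_of_nonneg hy0]; exact hy1)
                  rw [abs_of_nonneg hy0] at this
                  have := le_abs_self (Real.exp (θ * tdeg f v) - 1)
                  linarith
                have h3 : (k : ℝ) / n * (Real.exp (θ * tdeg f v) - 1) ≤ (k : ℝ) / n * (2 * θ * tdeg f v) := by gcongr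
                have := Real.add_one_le_exp ((k : ℝ) / n * (2 * θ * tdeg f v))
                linarith
          _ = Real.exp ((k : ℝ) / n * (2 * θ * ∑ v ∈ Finset.univ.erase x, (tdeg f v : ℝ))) := by
              rw [← Real.exp_sum, ← Finset.mul_sum, ← Finset.mul_sum]
          _ ≤ _ := by
              apply Real.exp_le_exp.2
              have h4 : ∑ v ∈ Finset.univ.erase x, (tdeg f v : ℝ) ≤ g * k := by
                have h5 : ∑ v ∈ Finset.univ.erase x, tdeg f v ≤ ∑ v, tdeg f v :=
                  Finset.sum_le_sum_of_subset (Finset.erase_subset _ _)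
                rw [sum_tdeg f hf2] at h5
                have h6 : s * k ≤ g * k := Nat.mul_le_mul_right _ (by omega)
                exact_mod_cast h5.trans h6
              calc _ ≤ (k : ℝ) / n * (2 * θ * (g * k)) := by gcongr
                _ = _ := by ring
      calc _ ≤ ∑ A ∈ kSets n k, Real.exp (θ * XX x f) * ∏ v ∈ A ∩ Finset.univ.erase x, Real.exp (θ * tdeg f v) := by
            apply Finset.sum_le_sum
            intro A _
            rw [← Real.exp_sum, ← Real.exp_add, ← Finset.mul_sum, ← mul_add, XX_snoc]
            push_cast
            split_ifs
            · exact le_rfl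
            · positivity
        _ = Real.exp (θ * XX x f) * ∑ A ∈ kSets n k, ∏ v ∈ A ∩ Finset.univ.erase x, Real.exp (θ * tdeg f v) := by
            rw [Finset.mul_sum]
        _ ≤ Real.exp (θ * XX x f) * C := by
            apply mul_le_mul_of_nonneg_left _ (Real.exp_pos _).le
            refine hm.trans ?_
            rw [hC]
            gcongr
    · apply Finset.sum_nonpos
      intro A _
      rw [if_neg]
      intro h
      apply hdeg
      intro v hv
      have := h v hv
      rw [tdeg_snoc] at this
      refine le_trans ?_ this
      exact_mod_cast Nat.le_add_right _ _

lemma card_kSets (n k : ℕ) : (kSets n k).card = n.choose k := by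
  simp [kSets]

lemma card_kTup (n k s : ℕ) : (kTup n k s).card = n.choose k ^ s := by
  simp [kTup, card_kSets]

lemma interProb_eq (n k : ℕ) (h : 2 * k ≤ n) : interProb n k = qf n k := by
  classical
  have hpos : (0:ℝ) < n.choose k := by exact_mod_cast Nat.choose_pos (by omega)
  have key : ∀ A ∈ kSets n k, ((kSets n k).filter fun B => ¬ (A ∩ B).Nonempty).card = (n - k).choose k := by
    intro A hA
    have hA' : A.card = k := by simpa [kSets] using hA
    have : ((kSets n k).filter fun B => ¬ (A ∩ B).Nonempty) = Finset.powersetCard k (Finset.univ \ A) := by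
      ext B
      simp only [kSets, Finset.mem_filter, Finset.mem_powersetCard, Finset.subset_univ, true_and,
        Finset.not_nonempty_iff_eq_empty]
      rw [← Finset.disjoint_iff_inter_eq_empty]
      constructor
      · rintro ⟨a, b⟩
        refine ⟨?_, a⟩
        intro v hv
        simp [Finset.disjoint_right.1 b hv]
      · rintro ⟨a, b⟩
        refine ⟨b, ?_⟩
        rw [Finset.disjoint_right]
        intro v hv
        exact (Finset.mem_sdiff.1 (a hv)).2
    rw [this, Finset.card_powersetCard, Finset.card_sdiff_of_subset (Finset.subset_univ _), hA']
    simp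
  have hc : (((kSets n k) ×ˢ (kSets n k)).filter fun AB => ¬ (AB.1 ∩ AB.2).Nonempty).card = n.choose k * (n - k).choose k := by
    rw [Finset.card_filter, Finset.sum_product]
    simp_rw [← Finset.card_filter]
    rw [Finset.sum_congr rfl key]
    simp [card_kSets]
  have hs := Finset.card_filter_add_card_filter_not (fun AB : Finset (Fin n) × Finset (Fin n) => (AB.1 ∩ AB.2).Nonempty) (s := (kSets n k) ×ˢ (kSets n k))
  rw [hc, Finset.card_product, card_kSets] at hs
  have hs' : ((((kSets n k) ×ˢ (kSets n k)).filter fun AB => (AB.1 ∩ AB.2).Nonempty).card : ℝ) + n.choose k * (n - k).choose k = n.choose k * n.choose k := by exact_mod_cast hs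
  unfold interProb qf
  rw [card_kSets]
  rw [eq_sub_of_add_eq hs']
  field_simp

open Classical in
lemma markov_count {n : ℕ} (k g : ℕ) (T lam θ : ℝ) (hk : k ≤ n) (hθ : 0 ≤ θ) (hθl : θ * lam ≤ 1) (x : Fin n) :
    (((kTup n k g).filter (fun f => (∀ v, v ≠ x → (tdeg f v : ℝ) ≤ lam) ∧ T < (XX x f : ℝ))).card : ℝ) ≤
      Real.exp (-(θ * T)) * ((n.choose k : ℝ) * Real.exp (2 * θ * k ^ 2 * g / n)) ^ g := by
  have h := mgf_seq (n := n) k g lam θ hk hθ hθl x g le_rfl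
  refine le_trans ?_ (mul_le_mul_of_nonneg_left h (Real.exp_pos _).le)
  rw [Finset.mul_sum, ← Finset.filter_filter, Finset.card_filter]
  push_cast
  apply Finset.sum_le_sum
  intro f _
  split_ifs with hf
  · rw [← Real.exp_add]
    apply Real.one_le_exp
    nlinarith
  · positivity

/-- main sum -/
noncomputable def bterm (n k g d : ℕ) : ℝ :=
  (g.choose d : ℝ) * ((k : ℝ) / n) ^ d / qf n k ^ (d.choose 2)

lemma bterm_nonneg (n k g d : ℕ) : 0 ≤ bterm n k g d := by
  unfold bterm
  have := qf_nonneg n k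
  positivity

open Classical in
lemma main_comb {n : ℕ} (k g : ℕ) (T lam θ τ : ℝ) (hn : 0 < n) (h1 : 4 * k ≤ n) (h2 : 2 * (T + 1 + k) ≤ n)
    (hq : 0 < qf n k) (hq1 : qf n k < 1) (hθ : 0 ≤ θ) (hθl : θ * lam ≤ 1) :
    tupleProb n k g (fun f =>
        (∀ i j, i ≠ j → (f i ∩ f j).Nonempty) ∧
        (∀ v w : Fin n, lam < (tdeg f v : ℝ) →
          lam < (tdeg f w : ℝ) → v = w) ∧
        (∀ v : Fin n, (tdeg f v : ℝ) < τ)) ≤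
      n * (Real.exp (-(θ * T)) * Real.exp (2 * θ * k ^ 2 * g / n) ^ g) +
      Real.exp (eE n k g T lam) ^ g * qf n k ^ (g.choose 2) *
        ∑ d ∈ (Finset.range (g+1)).filter (fun d : ℕ => (d:ℝ) < τ),
          (if (d:ℝ) ≤ lam then 1 else (n:ℝ)) * bterm n k g d := by
  have hN : (0:ℝ) < n.choose k := by exact_mod_cast Nat.choose_pos (by omega)
  have hset : ((Finset.univ : Finset (Fin g → Finset (Fin n))).filter fun f => ∀ i, f i ∈ kSets n k) = kTup n k g := by
    ext f; simp [kTup]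
  unfold tupleProb uprob
  rw [hset, card_kTup]
  push_cast
  rw [div_le_iff₀ (by positivity)]
  set x0 : Fin n := ⟨0, hn⟩
  let Xs : ℕ → Finset (Fin n) := fun d => if (d:ℝ) ≤ lam then {x0} else Finset.univ
  have hXs : ∀ d, ((Xs d).card : ℝ) = if (d:ℝ) ≤ lam then 1 else (n:ℝ) := by
    intro d
    simp only [Xs]
    split_ifs <;> simp
  set D := (Finset.range (g+1)).filter (fun d : ℕ => (d:ℝ) < τ) with hD
  have hsub : ((kTup n k g).filter (fun f =>
        (∀ i j, i ≠ j → (f i ∩ f j).Nonempty) ∧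
        (∀ v w : Fin n, lam < (tdeg f v : ℝ) →
          lam < (tdeg f w : ℝ) → v = w) ∧
        (∀ v : Fin n, (tdeg f v : ℝ) < τ))) ⊆
      (Finset.univ.biUnion fun x => (kTup n k g).filter
        (fun f => (∀ v, v ≠ x → (tdeg f v : ℝ) ≤ lam) ∧ T < (XX x f : ℝ))) ∪
      D.biUnion fun d => (Finset.powersetCard d (Finset.range g)).biUnion fun I =>
        (Xs d).biUnion fun x => (kTup n k g).filter (Good x I T lam) := by
    intro f hf
    rw [Finset.mem_filter] at hf
    obtain ⟨hf0, hcl, huniq, hdeg⟩ := hf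
    obtain ⟨x, hx1, hx2⟩ : ∃ x : Fin n, (∀ v, v ≠ x → (tdeg f v : ℝ) ≤ lam) ∧ x ∈ Xs (tdeg f x) := by
      by_cases hex : ∃ v, lam < (tdeg f v : ℝ)
      · obtain ⟨v, hv⟩ := hex
        refine ⟨v, ?_, ?_⟩
        · intro w hw
          by_contra hc
          exact hw (huniq _ _ (not_le.1 hc) hv)
        · simp only [Xs]
          rw [if_neg (not_le.2 hv)]
          simp
      · push Not at hex
        refine ⟨x0, fun v _ => hex v, ?_⟩
        simp only [Xs]
        rw [if_pos (hex _)]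
        simp
    rw [Finset.mem_union]
    by_cases hT : T < (XX x f : ℝ)
    · left
      rw [Finset.mem_biUnion]
      exact ⟨x, Finset.mem_univ _, Finset.mem_filter.2 ⟨hf0, hx1, hT⟩⟩
    · right
      rw [Finset.mem_biUnion]
      refine ⟨tdeg f x, ?_, ?_⟩
      · rw [hD, Finset.mem_filter, Finset.mem_range]
        refine ⟨?_, hdeg x⟩
        have : tdeg f x ≤ (Finset.univ : Finset (Fin g)).card := Finset.card_filter_le _ _
        simp at this
        omega
      · rw [Finset.mem_biUnion]
        refine ⟨(Finset.univ.filter fun i => x ∈ f i).image (fun i : Fin g => (i:ℕ)), ?_, ?_⟩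
        · rw [Finset.mem_powersetCard]
          refine ⟨?_, ?_⟩
          · intro j hj
            rw [Finset.mem_image] at hj
            obtain ⟨i, _, rfl⟩ := hj
            exact Finset.mem_range.2 i.2
          · rw [Finset.card_image_of_injective _ Fin.val_injective]
            rfl
        · rw [Finset.mem_biUnion]
          refine ⟨x, hx2, Finset.mem_filter.2 ⟨hf0, hcl, hx1, not_lt.1 hT, ?_⟩⟩
          intro i
          simp only [Finset.mem_image, Finset.mem_filter, Finset.mem_univ, true_and]
          constructor
          · intro h; exact ⟨i, h, rfl⟩
          · rintro ⟨j, h, e⟩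
            rw [← Fin.ext e]; exact h
  have hcard : ∀ d, ∀ I ∈ Finset.powersetCard d (Finset.range g), ∀ x : Fin n,
      (((kTup n k g).filter (Good x I T lam)).card : ℝ) ≤
        (n.choose k : ℝ) ^ g * (Real.exp (eE n k g T lam) ^ g * qf n k ^ (g.choose 2)) * (((k : ℝ) / n) ^ d / qf n k ^ (d.choose 2)) := by
    intro d I hI x
    rw [Finset.mem_powersetCard] at hI
    have h := good_count (n := n) k g T lam h1 h2 hq hq1 x I g le_rfl
    have hfil : I.filter (· < g) = I := by
      rw [Finset.filter_true_of_mem]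
      intro j hj
      exact Finset.mem_range.1 (hI.1 hj)
    rw [hfil, hI.2] at h
    rw [← mul_div_assoc, le_div_iff₀ (by positivity)]
    refine h.trans (le_of_eq ?_)
    ring
  have step1 : (((Finset.univ : Finset (Fin n)).biUnion fun x => (kTup n k g).filter
        (fun f => (∀ v, v ≠ x → (tdeg f v : ℝ) ≤ lam) ∧ T < (XX x f : ℝ))).card : ℝ) ≤
        n * (Real.exp (-(θ * T)) * ((n.choose k : ℝ) * Real.exp (2 * θ * k ^ 2 * g / n)) ^ g) := by
    refine le_trans (Nat.cast_le.2 Finset.card_biUnion_le) ?_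
    push_cast
    refine le_trans (Finset.sum_le_sum (fun x _ => markov_count k g T lam θ (by omega) hθ hθl x)) ?_
    simp
  have step2 : ((D.biUnion fun d => (Finset.powersetCard d (Finset.range g)).biUnion fun I =>
        (Xs d).biUnion fun x => (kTup n k g).filter (Good x I T lam)).card : ℝ) ≤
        ∑ d ∈ D, (if (d:ℝ) ≤ lam then 1 else (n:ℝ)) * bterm n k g d * ((n.choose k : ℝ) ^ g * (Real.exp (eE n k g T lam) ^ g * qf n k ^ (g.choose 2))) := by
    refine le_trans (Nat.cast_le.2 Finset.card_biUnion_le) ?_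
    push_cast
    apply Finset.sum_le_sum
    intro d _
    refine le_trans (Nat.cast_le.2 Finset.card_biUnion_le) ?_
    push_cast
    have : ∀ I ∈ Finset.powersetCard d (Finset.range g), (((Xs d).biUnion fun x => (kTup n k g).filter (Good x I T lam)).card : ℝ) ≤
       (if (d:ℝ) ≤ lam then 1 else (n:ℝ)) * ((n.choose k : ℝ) ^ g * (Real.exp (eE n k g T lam) ^ g * qf n k ^ (g.choose 2)) * (((k : ℝ) / n) ^ d / qf n k ^ (d.choose 2))) := by
      intro I hI
      refine le_trans (Nat.cast_le.2 Finset.card_biUnion_le) ?_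
      push_cast
      refine le_trans (Finset.sum_le_sum (fun x _ => hcard d I hI x)) ?_
      rw [Finset.sum_const, nsmul_eq_mul, hXs]
    refine le_trans (Finset.sum_le_sum this) ?_
    rw [Finset.sum_const, nsmul_eq_mul, Finset.card_powersetCard, Finset.card_range]
    unfold bterm
    apply le_of_eq
    ring
  have hcs := (Nat.cast_le (α := ℝ)).2 (Finset.card_le_card hsub)
  refine le_trans (le_trans (le_of_eq ?_) hcs) ?_
  · congr
  refine le_trans (Nat.cast_le.2 (Finset.card_union_le _ _)) ?_
  push_cast
  refine le_trans (add_le_add step1 step2) ?_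
  rw [← Finset.sum_mul, mul_pow]
  apply le_of_eq
  ring

lemma qf_lower (n k : ℕ) (hk : 0 < k) (h : 2 * k ≤ n) :
    (k:ℝ)^2 / n / (1 + (k:ℝ)^2/n) ≤ qf n k := by
  have hn : (0:ℝ) < n := by exact_mod_cast (by omega : 0 < n)
  have hkn : (2:ℝ) * k ≤ n := by exact_mod_cast h
  have hk0 : (0:ℝ) < k := by exact_mod_cast hk
  have h1 := one_sub_qf n k h
  have h2 : ∏ i ∈ Finset.range k, (((n:ℝ) - k - i) / (n - i)) ≤ ∏ i ∈ Finset.range k, Real.exp (-(k/n:ℝ)) := by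
    apply Finset.prod_le_prod
    · intro i hi
      have hi' : (i:ℝ) < k := by exact_mod_cast Finset.mem_range.1 hi
      apply div_nonneg <;> linarith
    · intro i hi
      have hi' : (i:ℝ) < k := by exact_mod_cast Finset.mem_range.1 hi
      have hi0 : (0:ℝ) ≤ i := by positivity
      have := Real.add_one_le_exp (-(k/n:ℝ))
      refine le_trans ?_ this
      rw [div_le_iff₀ (by linarith)]
      have : (-(k/n:ℝ)+1) * (n - i) = n - k - i + k/n*i := by field_simp; ring
      rw [this]
      have : (0:ℝ) ≤ k/n*i := by positivity
      linarith
  rw [← h1, Finset.prod_const, Finset.card_range, ← Real.exp_nat_mul] at h2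
  set x := (k:ℝ)^2/n with hx
  have hx0 : 0 < x := by positivity
  have e : (k:ℝ) * (-(k/n:ℝ)) = -x := by rw [hx]; ring
  rw [e] at h2
  have h3 : Real.exp (-x) ≤ 1/(1+x) := by
    rw [Real.exp_neg, ← one_div]
    apply one_div_le_one_div_of_le (by linarith)
    linarith [Real.add_one_le_exp x]
  have h4 : x/(1+x) = 1 - 1/(1+x) := by field_simp; ring
  rw [h4]; linarith

lemma qf_upper (n k : ℕ) (hk : 0 < k) (h : 2 * k < n) :
    Real.exp (-((k:ℝ)^2 / (n - 2*k))) ≤ 1 - qf n k := by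
  have hn : (0:ℝ) < n := by exact_mod_cast (by omega : 0 < n)
  have hkn : (2:ℝ) * k < n := by exact_mod_cast h
  have hk0 : (0:ℝ) < k := by exact_mod_cast hk
  rw [one_sub_qf n k h.le]
  have h2 : ∏ i ∈ Finset.range k, Real.exp (-((k:ℝ)/(n-2*k))) ≤ ∏ i ∈ Finset.range k, (((n:ℝ) - k - i) / (n - i)) := by
    apply Finset.prod_le_prod
    · intro i hi
      positivity
    · intro i hi
      have hi' : (i:ℝ) < k := by exact_mod_cast Finset.mem_range.1 hi
      have hi0 : (0:ℝ) ≤ i := by positivity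
      have hpos : (0:ℝ) < n - 2*k := by linarith
      have := Real.add_one_le_exp (((k:ℝ)/(n-2*k)))
      rw [Real.exp_neg, inv_le_comm₀ (Real.exp_pos _) (by apply div_pos <;> linarith)]
      refine le_trans ?_ this
      rw [inv_div, div_le_iff₀ (by linarith)]
      have e : ((k:ℝ)/(n-2*k)+1) * (n - k - i) = n - k - i + k * ((n-k-i)/(n-2*k)) := by ring
      rw [e]
      have : 1 ≤ (n-k-i)/((n:ℝ)-2*k) := by rw [le_div_iff₀ hpos]; linarith
      nlinarith
  rw [Finset.prod_const, Finset.card_range, ← Real.exp_nat_mul] at h2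
  refine le_trans (le_of_eq ?_) h2
  congr 1
  ring

/-- basic quantitative environment -/
structure Env (ε κ : ℝ) (n k : ℕ) : Prop where
  hε0 : 0 < ε
  hε1 : ε < 1/4
  hκ0 : 0 < κ
  hκ1 : κ ≤ ε^2/64
  hL : 100/κ^2 ≤ Real.log n
  hP : 10^6 * Real.log n ^ 20 ≤ Real.exp (κ * Real.log n)
  klo : Real.exp ((1/2 - κ^2/4) * Real.log n) ≤ k
  khi : (k:ℝ)^2 ≤ (1/4 - ε) * n * Real.log n

namespace Env
variable {ε κ : ℝ} {n k : ℕ}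

lemma kap (h : Env ε κ n k) : κ ≤ ε/256 ∧ κ ≤ 1/1024 := by
  have := h.hκ1; have := h.hε0; have := h.hε1
  constructor <;> nlinarith

lemma L1 (h : Env ε κ n k) : 10^6 ≤ Real.log n := by
  refine le_trans ?_ h.hL
  have := h.hκ0; have := h.kap.2
  rw [le_div_iff₀ (by positivity)]
  nlinarith

lemma Lκ (h : Env ε κ n k) : 100 ≤ κ^2 * Real.log n := by
  have := h.hL
  have := h.hκ0
  rw [div_le_iff₀ (by positivity)] at *
  linarith

lemma npos (h : Env ε κ n k) : (0:ℝ) < n := by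
  by_contra hc
  have : (n:ℝ) = 0 := le_antisymm (not_lt.1 hc) (by positivity)
  have h1 := h.L1
  rw [this] at h1
  norm_num at h1

lemma nexp (h : Env ε κ n k) : (n:ℝ) = Real.exp (Real.log n) := (Real.exp_log h.npos).symm

lemma kpos (h : Env ε κ n k) : (0:ℝ) < k := lt_of_lt_of_le (Real.exp_pos _) h.klo

lemma pw (h : Env ε κ n k) (c : ℝ) (j : ℕ) (hj : j ≤ 20) (hc : c ≤ 10^6) :
    c * Real.log n ^ j ≤ Real.exp (κ * Real.log n) := by
  have h1 : (1:ℝ) ≤ Real.log n := by linarith [h.L1]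
  calc c * Real.log n ^ j ≤ 10^6 * Real.log n ^ j := by gcongr
    _ ≤ 10^6 * Real.log n ^ 20 := by gcongr
    _ ≤ _ := h.hP

lemma kn_le (h : Env ε κ n k) : (k:ℝ)/n ≤ Real.exp (-(1/2-κ) * Real.log n) := by
  have hn := h.npos
  apply le_of_sq_le_sq₀ _ (Real.exp_pos _).le
  rw [div_pow, ← Real.exp_nat_mul, div_le_iff₀ (by positivity)]
  have e : Real.exp ((2:ℕ) * (-(1/2-κ) * Real.log n)) * (n:ℝ)^2 = n * Real.exp (κ * Real.log n)^2 := by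
    conv_lhs => rw [h.nexp]
    conv_rhs => rw [h.nexp]
    simp only [Real.log_exp]
    rw [← Real.exp_nat_mul, ← Real.exp_nat_mul, ← Real.exp_add, ← Real.exp_add]
    congr 1; push_cast; ring
  rw [e]
  have h1 := h.pw 1 1 (by norm_num) (by norm_num)
  have h2 : 1 ≤ Real.exp (κ * Real.log n) := Real.one_le_exp (by have := h.hκ0; have := h.L1; positivity)
  have h3 : Real.log n ≤ Real.exp (κ * Real.log n)^2 := by nlinarith
  have := h.khi
  have := h.hε0
  have hL := h.L1
  have h4 : 0 ≤ n * Real.log n := by positivity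
  calc (k:ℝ)^2 ≤ (1/4 - ε) * n * Real.log n := h.khi
    _ ≤ n * Real.log n := by nlinarith
    _ ≤ _ := by gcongr
where le_of_sq_le_sq₀ {a b : ℝ} (h : a^2 ≤ b^2) (hb : 0 ≤ b) : a ≤ b := (abs_le_of_sq_le_sq' h hb).2

lemma nk_ge (h : Env ε κ n k) : Real.exp ((1/2-κ) * Real.log n) ≤ (n:ℝ)/k := by
  have := h.kn_le
  have hn := h.npos
  have hk := h.kpos
  rw [← inv_div (k:ℝ) n, le_inv_comm₀ (Real.exp_pos _) (by positivity), ← Real.exp_neg]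
  rw [← neg_mul]; exact this

lemma nk_le (h : Env ε κ n k) : (n:ℝ)/k ≤ Real.exp ((1/2+κ) * Real.log n) := by
  have hk := h.kpos
  rw [div_le_iff₀ hk]
  refine le_trans ?_ (mul_le_mul_of_nonneg_left h.klo (Real.exp_pos _).le)
  rw [← Real.exp_add]
  conv_lhs => rw [h.nexp]
  apply Real.exp_le_exp.2
  have := h.hκ0; have := h.kap.2; have := h.L1
  nlinarith [mul_pos h.hκ0 (show 0 < Real.log n by linarith)]

lemma kn_eps (h : Env ε κ n k) : (k:ℝ)/n ≤ ε/100 := by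
  have h1 := h.kn_le
  have h2 := h.pw (10^6) 1 (by norm_num) (by norm_num)
  have hL := h.L1
  have h3 : Real.exp (-(1/2-κ) * Real.log n) ≤ Real.exp (-(κ * Real.log n)) := by
    apply Real.exp_le_exp.2
    have := h.kap.2
    nlinarith
  have h4 : Real.exp (-(κ * Real.log n)) ≤ 1/(10^6 * Real.log n) := by
    rw [Real.exp_neg, ← one_div]
    apply one_div_le_one_div_of_le (by positivity)
    simpa using h2
  have h5 : 1/(10^6 * Real.log n) ≤ ε / 100 := by
    rw [div_le_div_iff₀ (by positivity) (by norm_num)]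
    have h6 : 1 ≤ ε * Real.log n := by
      have := h.Lκ
      have := h.hκ0; have := h.kap; have := h.hε0
      have : κ^2 ≤ ε := by nlinarith
      nlinarith
    nlinarith
  linarith

lemma kn6 (h : Env ε κ n k) : 6 * k ≤ n := by
  have h1 := h.kn_eps
  have := h.hε1
  have hn := h.npos
  rw [div_le_iff₀ hn] at h1
  have : (6:ℝ) * k ≤ n := by nlinarith
  exact_mod_cast this

lemma x_hi (h : Env ε κ n k) : (k:ℝ)^2/n ≤ Real.log n := by
  have hn := h.npos
  rw [div_le_iff₀ hn]
  have := h.khi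
  have := h.hε0
  have hL := h.L1
  have h4 : 0 ≤ n * Real.log n := by positivity
  nlinarith

lemma x_lo (h : Env ε κ n k) : Real.exp (-(κ^2/2) * Real.log n) ≤ (k:ℝ)^2/n := by
  have hn := h.npos
  rw [le_div_iff₀ hn]
  conv_lhs => rw [h.nexp]
  rw [Real.log_exp, ← Real.exp_add]
  have : Real.exp (-(κ ^ 2 / 2) * Real.log n + Real.log n) = Real.exp ((1/2 - κ^2/4) * Real.log n)^2 := by
    rw [← Real.exp_nat_mul]; congr 1; push_cast; ring
  rw [this]
  exact pow_le_pow_left₀ (Real.exp_pos _).le h.klo 2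

lemma q_lo (h : Env ε κ n k) : Real.exp (-(κ^2) * Real.log n) ≤ qf n k := by
  have hk : 0 < k := by exact_mod_cast h.kpos
  refine le_trans ?_ (qf_lower n k hk (by have := h.kn6; omega))
  have hx := h.x_lo
  set x := (k:ℝ)^2/n
  have hx0 : 0 < x := lt_of_lt_of_le (Real.exp_pos _) hx
  rw [le_div_iff₀ (by linarith)]
  set y := Real.exp (-(κ^2/2) * Real.log n) with hy
  have e : Real.exp (-(κ^2) * Real.log n) = y * y := by
    rw [hy, ← Real.exp_add]; congr 1; ring
  have hy0 : 0 < y := Real.exp_pos _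
  have hy1 : y ≤ 1/2 := by
    have h1 : y ≤ Real.exp (-1) := by
      apply Real.exp_le_exp.2
      linarith [h.Lκ]
    have := Real.exp_neg_one_lt_half
    linarith
  rw [e]
  nlinarith [mul_pos hy0 hx0]

lemma q0 (h : Env ε κ n k) : 0 < qf n k := lt_of_lt_of_le (Real.exp_pos _) h.q_lo

lemma q_hi (h : Env ε κ n k) : Real.exp (-(1/4-ε/2) * Real.log n) ≤ 1 - qf n k := by
  have hk : 0 < k := by exact_mod_cast h.kpos
  refine le_trans ?_ (qf_upper n k hk (by have := h.kn6; omega))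
  apply Real.exp_le_exp.2
  have hk6 : (6:ℝ) * k ≤ n := by exact_mod_cast h.kn6
  have hkp := h.kpos
  have hn := h.npos
  rw [neg_mul]
  apply neg_le_neg
  rw [div_le_iff₀ (by linarith)]
  refine h.khi.trans ?_
  have h1 := h.kn_eps
  rw [div_le_iff₀ hn] at h1
  have hL := h.L1
  have := h.hε0; have := h.hε1
  have : (1/4 - ε) * n ≤ (1/4 - ε/2) * (n - 2*k) := by nlinarith
  nlinarith

lemma q1 (h : Env ε κ n k) : qf n k < 1 := by
  have := h.q_hi
  have := Real.exp_pos (-(1/4-ε/2) * Real.log n)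
  linarith

lemma iP (h : Env ε κ n k) : interProb n k = qf n k := interProb_eq n k (by have := h.kn6; omega)

lemma a_lo (h : Env ε κ n k) : Real.exp (-(1/4-ε/2) * Real.log n) ≤ Real.log (1/qf n k) := by
  refine h.q_hi.trans ?_
  rw [one_div, Real.log_inv]
  linarith [Real.log_le_sub_one_of_pos h.q0]

lemma a0 (h : Env ε κ n k) : 0 < Real.log (1/qf n k) := lt_of_lt_of_le (Real.exp_pos _) h.a_lo

lemma q_exp (h : Env ε κ n k) : qf n k = Real.exp (-Real.log (1/qf n k)) := by
  rw [one_div, Real.log_inv, neg_neg, Real.exp_log h.q0]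

lemma a_hi (h : Env ε κ n k) : Real.log (1/qf n k) ≤ κ^2 * Real.log n := by
  have := h.q_lo
  rw [h.q_exp, Real.exp_le_exp] at this
  linarith

lemma ainv (h : Env ε κ n k) : 1 / Real.log (1/qf n k) ≤ Real.exp ((1/4-ε/2) * Real.log n) := by
  rw [one_div, inv_le_comm₀ h.a0 (Real.exp_pos _), ← Real.exp_neg, ← neg_mul]
  exact h.a_lo

lemma lam_eq (h : Env ε κ n k) : lamP n k =
    max (Real.sqrt (Real.log n) / Real.log (1 / qf n k)) (2 * Real.sqrt (Real.log n / Real.log (1 / qf n k))) := by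
  unfold lamP; rw [h.iP]

lemma lam_lo (h : Env ε κ n k) : 2/κ ≤ lamP n k := by
  rw [h.lam_eq]
  refine le_trans ?_ (le_max_right _ _)
  have h0 := h.hκ0
  have : 1/κ ≤ Real.sqrt (Real.log n / Real.log (1 / qf n k)) := by
    apply Real.le_sqrt_of_sq_le
    rw [le_div_iff₀ h.a0, div_pow, one_pow, div_mul_eq_mul_div, div_le_iff₀ (by positivity)]
    linarith [h.a_hi]
  have e : 2/κ = 2 * (1/κ) := by ring
  rw [e]; linarith

lemma lam_lo2 (h : Env ε κ n k) : Real.sqrt (Real.log n) ≤ Real.log (1 / qf n k) * lamP n k := by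
  rw [h.lam_eq, ← div_le_iff₀' h.a0]
  exact le_max_left _ _

lemma lam_hi (h : Env ε κ n k) : Real.log (1 / qf n k) * lamP n k ≤ 2 * κ * Real.log n := by
  have ha := h.a0
  have hκ := h.hκ0
  have hL := h.L1
  rw [h.lam_eq, ← le_div_iff₀' ha]
  apply max_le
  · apply div_le_div_of_nonneg_right _ ha.le
    apply Real.sqrt_le_iff.2
    refine ⟨by positivity, ?_⟩
    have := h.Lκ
    nlinarith
  · have e : 2 * κ * Real.log n / Real.log (1 / qf n k) = 2 * (κ * Real.log n / Real.log (1 / qf n k)) := by ring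
    rw [e]
    apply mul_le_mul_of_nonneg_left _ (by norm_num)
    apply Real.sqrt_le_iff.2
    refine ⟨by positivity, ?_⟩
    rw [div_pow, div_le_div_iff₀ ha (by positivity)]
    have := h.a_hi
    have : Real.log n * Real.log (1/qf n k) * Real.log (1/qf n k) ≤ Real.log n * Real.log (1/qf n k) * (κ^2 * Real.log n) := by
      apply mul_le_mul_of_nonneg_left this; positivity
    nlinarith

lemma lam_hi2 (h : Env ε κ n k) : lamP n k ≤ Real.log n / Real.log (1 / qf n k) := by
  rw [le_div_iff₀' h.a0]
  have := h.lam_hi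
  have := h.kap.2
  have := h.L1
  nlinarith

lemma lam0 (h : Env ε κ n k) : 0 < lamP n k := lt_of_lt_of_le (by have := h.hκ0; positivity) h.lam_lo

lemma phiS (h : Env ε κ n k) : phiStar n k = Real.log n ^ 3 / Real.log (1/qf n k) := by
  unfold phiStar; rw [h.iP]
end Env

lemma hprob_mono {n k : ℕ} {p : ℝ} (h0 : 0 ≤ p) (h1 : p ≤ 1) {P Q : Finset (Finset (Fin n)) → Prop}
    (h : ∀ H, P H → Q H) : hprob n k p P ≤ hprob n k p Q := by
  classical
  unfold hprob
  apply Finset.sum_le_sum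
  intro H _
  have : 0 ≤ 1 - p := by linarith
  split_ifs with a b
  · exact le_rfl
  · exact absurd (h H a) b
  · positivity
  · exact le_rfl

lemma hprob_true {n k : ℕ} {p : ℝ} : hprob n k p (fun _ => True) = 1 := by
  unfold hprob
  simp only [if_true]
  rw [Finset.sum_pow_mul_eq_add_pow]
  simp

lemma hprob_or {n k : ℕ} {p : ℝ} (h0 : 0 ≤ p) (h1 : p ≤ 1) (P Q : Finset (Finset (Fin n)) → Prop) :
    hprob n k p (fun H => P H ∨ Q H) ≤ hprob n k p P + hprob n k p Q := by
  classical
  unfold hprob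
  rw [← Finset.sum_add_distrib]
  apply Finset.sum_le_sum
  intro H _
  have : 0 ≤ 1 - p := by linarith
  have : 0 ≤ p ^ H.card * (1 - p) ^ ((kSets n k).card - H.card) := by positivity
  by_cases a : P H <;> by_cases b : Q H <;> simp [a, b, this]

lemma hprob_union {ι : Type*} {n k : ℕ} {p : ℝ} (h0 : 0 ≤ p) (h1 : p ≤ 1) (I : Finset ι)
    (P : ι → Finset (Finset (Fin n)) → Prop) :
    hprob n k p (fun H => ∃ i ∈ I, P i H) ≤ ∑ i ∈ I, hprob n k p (P i) := by
  classical
  induction I using Finset.induction_on with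
  | empty => simp [hprob]
  | insert a s ha ih =>
    rw [Finset.sum_insert ha]
    refine le_trans (hprob_mono h0 h1 (Q := fun H => P a H ∨ ∃ i ∈ s, P i H) ?_) ((hprob_or h0 h1 _ _).trans ?_)
    · rintro H ⟨i, hi, hP⟩
      rcases Finset.mem_insert.1 hi with rfl | hi
      · exact Or.inl hP
      · exact Or.inr ⟨i, hi, hP⟩
    · linarith

lemma hprob_subset {n k : ℕ} {p : ℝ} (S : Finset (Finset (Fin n))) (hS : S ⊆ kSets n k) :
    hprob n k p (fun H => S ⊆ H) = p ^ S.card := by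
  classical
  unfold hprob
  have e0 : ∀ (dec : DecidablePred fun H => S ⊆ H), ∑ H ∈ (kSets n k).powerset,
      (@ite _ (S ⊆ H) (dec H) (p ^ H.card * (1 - p) ^ ((kSets n k).card - H.card)) 0) =
      ∑ H ∈ (kSets n k).powerset.filter (fun H => S ⊆ H), p ^ H.card * (1 - p) ^ ((kSets n k).card - H.card) := by
    intro dec
    rw [Finset.sum_filter]
  refine (e0 _).trans ?_
  have : ∑ G ∈ (kSets n k \ S).powerset, p ^ S.card * (p ^ G.card * (1-p) ^ ((kSets n k \ S).card - G.card)) = p ^ S.card := by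
    rw [← Finset.mul_sum, Finset.sum_pow_mul_eq_add_pow]; simp
  rw [← this]
  apply Finset.sum_nbij' (fun H => H \ S) (fun G => G ∪ S)
  · intro H hH
    simp only [Finset.mem_filter, Finset.mem_powerset] at hH ⊢
    exact Finset.sdiff_subset_sdiff hH.1 le_rfl
  · intro G hG
    simp only [Finset.mem_filter, Finset.mem_powerset] at hG ⊢
    exact ⟨Finset.union_subset (hG.trans Finset.sdiff_subset) hS, Finset.subset_union_right⟩
  · intro H hH
    simp only [Finset.mem_filter, Finset.mem_powerset] at hH ⊢
    exact Finset.sdiff_union_of_subset hH.2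
  · intro G hG
    simp only [Finset.mem_powerset] at hG
    ext A
    simp only [Finset.mem_sdiff, Finset.mem_union]
    constructor
    · rintro ⟨a | a, b⟩
      · exact a
      · exact absurd a b
    · intro a
      exact ⟨Or.inl a, (Finset.mem_sdiff.1 (hG a)).2⟩
  · intro H hH
    simp only [Finset.mem_filter, Finset.mem_powerset] at hH
    have e1 : (H \ S).card = H.card - S.card := Finset.card_sdiff_of_subset hH.2
    have e2 : (kSets n k \ S).card = (kSets n k).card - S.card := Finset.card_sdiff_of_subset hS
    have l1 := Finset.card_le_card hH.1
    have l2 := Finset.card_le_card hH.2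
    rw [e1, e2, ← mul_assoc, ← pow_add]
    congr 2 <;> omega

lemma hprob_empty {n k : ℕ} {p : ℝ} :
    hprob n k p (fun H => H = ∅) = (1 - p) ^ (n.choose k) := by
  classical
  unfold hprob
  rw [Finset.sum_eq_single_of_mem ∅ (by simp)]
  · simp [card_kSets]
  · intro H _ hne
    simp [hne]

lemma card_star (n k : ℕ) (hk : 1 ≤ k) (v : Fin n) : (starOf (kSets n k) v).card = (n-1).choose (k-1) := by
  unfold starOf kSets
  have := Finset.card_filter_powersetCard_subset {v} (Finset.univ : Finset (Fin n)) k (Finset.subset_univ _) (by simpa using hk)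
  simpa using this

lemma hprob_maxDegree {n k : ℕ} {p : ℝ} (h0 : 0 ≤ p) (h1 : p ≤ 1) (hk : 1 ≤ k) (t : ℕ) (ht : 1 ≤ t) :
    hprob n k p (fun H => t ≤ maxDegree H) ≤ n * phi n k p ^ t := by
  classical
  have e : hprob n k p (fun H => t ≤ maxDegree H) ≤
    hprob n k p (fun H => ∃ v ∈ (Finset.univ : Finset (Fin n)), ∃ S ∈ Finset.powersetCard t (starOf (kSets n k) v), S ⊆ H) := by
    unfold hprob
    apply Finset.sum_le_sum
    intro H hH
    rw [Finset.mem_powerset] at hH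
    have : 0 ≤ 1 - p := by linarith
    split_ifs with a b
    · exact le_rfl
    · exfalso
      apply b
      unfold maxDegree at a
      have a : t ≤ Finset.univ.sup (vdeg H) := a
      rw [Finset.le_sup_iff (show ⊥ < t by simpa [Nat.pos_iff_ne_zero] using (by omega : t ≠ 0))] at a
      obtain ⟨v, hv, hd⟩ := a
      obtain ⟨S, hS, hc⟩ := Finset.exists_subset_card_eq hd
      refine ⟨v, hv, S, ?_, ?_⟩
      · rw [Finset.mem_powersetCard]
        refine ⟨hS.trans ?_, hc⟩
        exact Finset.filter_subset_filter _ hH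
      · exact hS.trans (Finset.filter_subset _ _)
    · positivity
    · exact le_rfl
  refine e.trans ((hprob_union h0 h1 _ _).trans ?_)
  have : ∀ v ∈ (Finset.univ : Finset (Fin n)), hprob n k p (fun H => ∃ S ∈ Finset.powersetCard t (starOf (kSets n k) v), S ⊆ H) ≤ phi n k p ^ t := by
    intro v _
    refine (hprob_union h0 h1 _ _).trans ?_
    have : ∀ S ∈ Finset.powersetCard t (starOf (kSets n k) v), hprob n k p (fun H => S ⊆ H) = p ^ t := by
      intro S hS
      rw [Finset.mem_powersetCard] at hS
      rw [hprob_subset S (hS.1.trans (Finset.filter_subset _ _)), hS.2]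
    rw [Finset.sum_congr rfl this, Finset.sum_const, Finset.card_powersetCard, card_star n k hk, nsmul_eq_mul]
    unfold phi
    rw [mul_pow, mul_comm]
    apply mul_le_mul_of_nonneg_left _ (by positivity)
    exact_mod_cast Nat.choose_le_pow _ _
  refine (Finset.sum_le_sum this).trans ?_
  simp

lemma gchoose_lower (x : ℝ) (t : ℕ) (ht : (t:ℝ) ≤ x) : (x/t)^t ≤ gchoose x t := by
  unfold gchoose
  have hf : (t.factorial : ℝ) = ∏ i ∈ Finset.range t, ((t:ℝ) - i) := by
    rw [← Nat.descFactorial_self, Nat.descFactorial_eq_prod_range]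
    push_cast
    apply Finset.prod_congr rfl
    intro i hi
    rw [Nat.cast_sub (Finset.mem_range.1 hi).le]
  rw [hf, ← Finset.prod_div_distrib]
  have : (x/t)^t = ∏ i ∈ Finset.range t, (x/t) := by rw [Finset.prod_const, Finset.card_range]
  rw [this]
  apply Finset.prod_le_prod
  · intro i _
    have : (0:ℝ) ≤ t := by positivity
    have : 0 ≤ x := by linarith
    positivity
  · intro i hi
    have hi' : (i:ℝ) < t := by exact_mod_cast Finset.mem_range.1 hi
    have hi0 : (0:ℝ) ≤ i := by positivity
    rw [div_le_div_iff₀ (by linarith) (by linarith)]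
    nlinarith

lemma mubar_eq (n k : ℕ) (p : ℝ) (hk : 1 ≤ k) (hkn : k ≤ n) : mubar n k p = p * n.choose k := by
  unfold mubar phi
  have hk0 : (k:ℝ) ≠ 0 := by positivity
  obtain ⟨k', rfl⟩ : ∃ k', k = k' + 1 := ⟨k - 1, by omega⟩
  obtain ⟨n', rfl⟩ : ∃ n', n = n' + 1 := ⟨n - 1, by omega⟩
  have h : ((n'+1:ℕ):ℝ) * (n'.choose k' : ℝ) = ((n'+1).choose (k'+1) : ℝ) * ((k'+1:ℕ):ℝ) := by
    exact_mod_cast Nat.add_one_mul_choose_eq n' k'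
  simp only [Nat.add_sub_cancel]
  rw [div_eq_iff hk0]
  linear_combination p * h

/-- if `Λ(s) > σ` for all `s < t` then `n φ^t > 1 - υ`. -/
lemma phi_pow_lower {n k : ℕ} {p : ℝ} (h0 : 0 ≤ p) (h1 : p ≤ 1) (hk : 1 ≤ k) (σ υ : ℝ)
    (hLam : hprob n k p (fun H => σ < Lam n k p (maxDegree H)) < υ) (t : ℕ) (ht : 1 ≤ t)
    (hs : ∀ s < t, σ < Lam n k p s) : 1 - υ ≤ n * phi n k p ^ t := by
  have a1 := hprob_maxDegree (n := n) h0 h1 hk t ht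
  have a2 : hprob n k p (fun _ => True) ≤ _ := (hprob_mono h0 h1 (Q := fun H => t ≤ maxDegree H ∨ σ < Lam n k p (maxDegree H)) (by
    intro H _
    by_cases h : t ≤ maxDegree H
    · exact Or.inl h
    · exact Or.inr (hs _ (not_le.1 h)))).trans (hprob_or h0 h1 _ _)
  rw [hprob_true] at a2
  linarith

lemma exists_Lam {n k : ℕ} {p : ℝ} (σ υ : ℝ) (h0 : 0 ≤ p) (h1 : p ≤ 1)
    (hLam : hprob n k p (fun H => σ < Lam n k p (maxDegree H)) < υ) (hυ : υ ≤ 1) :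
    Lam n k p (alpha2 n k p σ) ≤ σ := by
  have : {t : ℕ | Lam n k p t ≤ σ}.Nonempty := by
    by_contra hc
    rw [Set.not_nonempty_iff_eq_empty] at hc
    have : ∀ t, σ < Lam n k p t := by
      intro t
      by_contra h
      have : t ∈ {t : ℕ | Lam n k p t ≤ σ} := not_lt.1 h
      rw [hc] at this
      exact this
    have := hprob_mono (n := n) (k := k) h0 h1 (P := fun _ => True) (Q := fun H => σ < Lam n k p (maxDegree H)) (fun H _ => this _)
    rw [hprob_true] at this
    linarith
  exact Nat.sInf_mem this

lemma Lam_zero (n k : ℕ) (p : ℝ) : Lam n k p 0 = 1 := by simp [Lam, gchoose]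

lemma Lam_one (n k : ℕ) (p : ℝ) : Lam n k p 1 = mubar n k p := by simp [Lam, gchoose]

lemma Lam_two (n k : ℕ) (p : ℝ) : Lam n k p 2 = mubar n k p * (mubar n k p - 1) / 2 * interProb n k := by
  simp [Lam, gchoose, Finset.prod_range_succ]

lemma phi_nonneg' {n k : ℕ} {p : ℝ} (h0 : 0 ≤ p) : 0 ≤ phi n k p := by unfold phi; positivity

lemma pow_lower_aux {L x : ℝ} (hx : 0 ≤ x) (t : ℕ) (ht : 1 ≤ t) (h : 1/2 ≤ Real.exp L * x ^ t) :
    Real.exp (-((L+1)/t)) ≤ x := by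
  by_contra hc
  have hc := not_le.1 hc
  have h1 : x ^ t < Real.exp (-((L+1)/t)) ^ t := pow_lt_pow_left₀ hc hx (by omega)
  rw [← Real.exp_nat_mul] at h1
  have ht0 : (t:ℝ) ≠ 0 := by positivity
  have e : (t:ℝ) * (-((L+1)/t)) = -L + -1 := by field_simp; ring
  rw [e, Real.exp_add, Real.exp_neg] at h1
  have h2 := mul_lt_mul_of_pos_left h1 (Real.exp_pos L)
  rw [← mul_assoc, mul_inv_cancel₀ (Real.exp_pos L).ne', one_mul] at h2
  have := Real.exp_neg_one_lt_half
  linarith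

namespace Env
variable {ε κ : ℝ} {n k : ℕ}

lemma hk1 (h : Env ε κ n k) : 1 ≤ k := by exact_mod_cast h.kpos

lemma mu3 (h : Env ε κ n k) {p σ υ : ℝ} (h0 : 0 ≤ p) (h1 : p ≤ 1) (hσ : σ < 1/12)
    (hυ : υ ≤ Real.exp (-6)) (hLam : hprob n k p (fun H => σ < Lam n k p (maxDegree H)) < υ) :
    3 ≤ mubar n k p := by
  have hk6 := h.kn6
  have hk1 := h.hk1
  have hkp := h.kpos
  by_cases hp : p ≤ 1/2
  · rw [mubar_eq n k p hk1 (by omega)]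
    have e := hprob_empty (n := n) (k := k) (p := p)
    have e2 := hprob_mono (n := n) (k := k) h0 h1 (P := fun H => H = ∅) (Q := fun H => σ < Lam n k p (maxDegree H)) (by
      rintro H rfl
      have : maxDegree (∅ : Finset (Finset (Fin n))) = 0 := by
        unfold maxDegree vdeg starOf
        simp
      rw [this, Lam_zero]; linarith)
    rw [e] at e2
    have h3 : Real.exp (-(2*p)) ≤ 1 - p := by
      have h4 : (2*p) + 1 ≤ Real.exp (2*p) := Real.add_one_le_exp _
      rw [Real.exp_neg, inv_le_comm₀ (Real.exp_pos _) (by linarith)]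
      refine le_trans ?_ h4
      rw [inv_le_iff_one_le_mul₀ (by linarith)]
      nlinarith
    have h5 : Real.exp (-(2*p)) ^ (n.choose k) ≤ (1-p)^(n.choose k) := pow_le_pow_left₀ (Real.exp_pos _).le h3 _
    rw [← Real.exp_nat_mul] at h5
    have h6 : Real.exp ((n.choose k : ℕ) * (-(2*p))) < Real.exp (-6) := by linarith
    rw [Real.exp_lt_exp] at h6
    linarith
  · have hp := not_le.1 hp
    have h2 : 1/2 ≤ phi n k p := by
      unfold phi
      have : (1:ℝ) ≤ (n-1).choose (k-1) := by exact_mod_cast Nat.choose_pos (by omega)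
      nlinarith
    unfold mubar
    rw [le_div_iff₀ hkp]
    have : (6:ℝ)*k ≤ n := by exact_mod_cast hk6
    nlinarith

set_option maxHeartbeats 1000000 in
lemma phi_lo (h : Env ε κ n k) {p σ υ : ℝ} (h0 : 0 ≤ p) (h1 : p ≤ 1) (hσ : σ < 1/12)
    (hυ : υ ≤ Real.exp (-6)) (hLam : hprob n k p (fun H => σ < Lam n k p (maxDegree H)) < υ) :
    Real.exp (-(κ * Real.log n)) ≤ phi n k p := by
  have hk6 := h.kn6
  have hk1 := h.hk1
  have hkp := h.kpos
  have hn := h.npos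
  have hμ := h.mu3 h0 h1 hσ hυ hLam
  have hκ := h.hκ0
  have hκ1 := h.kap.2
  have hL := h.L1
  have hυ2 : υ ≤ 1/2 := by
    have : Real.exp (-6) ≤ Real.exp (-1) := Real.exp_le_exp.2 (by norm_num)
    linarith [Real.exp_neg_one_lt_half]
  have hφ0 : 0 ≤ phi n k p := phi_nonneg' h0
  have key : ∀ t : ℕ, 1 ≤ t → (∀ s < t, σ < Lam n k p s) → 1/2 ≤ n * phi n k p ^ t := by
    intro t ht hs
    have := phi_pow_lower h0 h1 hk1 σ υ hLam t ht hs
    linarith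
  have L0 : σ < Lam n k p 0 := by rw [Lam_zero]; linarith
  have L1 : σ < Lam n k p 1 := by rw [Lam_one]; linarith
  have k2 := key 2 (by norm_num) (by
    intro s hs; interval_cases s
    · exact L0
    · exact L1)
  have L2 : σ < Lam n k p 2 := by
    rw [Lam_two, h.iP]
    have hq := qf_lower n k (by omega) (by omega)
    set μ := mubar n k p with hμd
    have hμφ : μ = phi n k p * n / k := rfl
    have hq0 := h.q0
    have hm1 : μ^2/3 ≤ μ*(μ-1)/2 := by nlinarith
    have hm2 : μ^2/3 * qf n k ≤ μ*(μ-1)/2 * qf n k := by gcongr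
    refine lt_of_lt_of_le ?_ hm2
    set x := (k:ℝ)^2/n with hx
    have hx0 : 0 < x := by positivity
    by_cases hx1 : x ≤ 1
    · have h2 : x/2 ≤ qf n k := by
        refine le_trans ?_ hq
        apply div_le_div_of_nonneg_left hx0.le (by linarith) (by linarith)
      have h3 : μ^2/3 * (x/2) ≤ μ^2/3 * qf n k := by gcongr
      have h4 : μ^2/3*(x/2) = n * phi n k p^2/6 := by
        rw [hμφ, hx]; field_simp; ring
      linarith
    · have h2 : 1/2 ≤ qf n k := by
        refine le_trans ?_ hq
        rw [le_div_iff₀ (by linarith)]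
        linarith [not_le.1 hx1]
      nlinarith
  have k3 := key 3 (by norm_num) (by
    intro s hs; interval_cases s
    · exact L0
    · exact L1
    · exact L2)
  have b3 := pow_lower_aux hφ0 3 (by norm_num) (L := Real.log n) (by rw [← h.nexp]; exact k3)
  have hμ7 : Real.exp (Real.log n/7) ≤ mubar n k p := by
    have e : mubar n k p = phi n k p * (n/k) := by unfold mubar; ring
    rw [e]
    refine le_trans ?_ (mul_le_mul b3 h.nk_ge (Real.exp_pos _).le hφ0)
    rw [← Real.exp_add]
    apply Real.exp_le_exp.2
    push_cast
    nlinarith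
  set D := ⌈2/κ⌉₊ with hD
  have hD1 : 2/κ ≤ D := Nat.le_ceil _
  have hD2 : (D:ℝ) ≤ 3/κ := by
    have := (Nat.ceil_lt_add_one (show 0 ≤ 2/κ by positivity)).le
    have h3 : 1 ≤ 1/κ := by rw [le_div_iff₀ hκ]; linarith
    have e : 3/κ = 2/κ + 1/κ := by ring
    rw [e]; linarith
  have hD0 : 1 ≤ D := by
    have : 0 < D := Nat.ceil_pos.2 (by positivity)
    omega
  have kD := key D hD0 (by
    intro s hs
    rcases Nat.eq_zero_or_pos s with rfl | hs0
    · exact L0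
    have hsD : (s:ℝ) ≤ 3/κ := le_trans (by exact_mod_cast hs.le) hD2
    have hsκ : κ * s ≤ 3 := by rw [le_div_iff₀ hκ] at hsD; linarith
    have hs0' : (0:ℝ) < s := by exact_mod_cast hs0
    have hsL : (s:ℝ) ≤ Real.exp (κ * Real.log n) := by
      have h2 := h.pw 1 1 (by norm_num) (by norm_num)
      have h3 := h.Lκ
      have : (s:ℝ) ≤ Real.log n := by
        have : κ * s ≤ κ * Real.log n := by nlinarith
        exact le_of_mul_le_mul_left this hκ
      linarith
    have hsμ : (s:ℝ) ≤ mubar n k p := hsL.trans (le_trans (Real.exp_le_exp.2 (by nlinarith)) hμ7)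
    have hbase : Real.exp ((1/7-κ)*Real.log n) ≤ mubar n k p / s := by
      rw [le_div_iff₀ hs0']
      refine le_trans ?_ hμ7
      refine le_trans (mul_le_mul_of_nonneg_left hsL (Real.exp_pos _).le) ?_
      rw [← Real.exp_add]
      apply Real.exp_le_exp.2; linarith
    have hg := gchoose_lower (mubar n k p) s hsμ
    have hg2 : Real.exp (s * ((1/7-κ)*Real.log n)) ≤ gchoose (mubar n k p) s := by
      rw [Real.exp_nat_mul]
      exact (pow_le_pow_left₀ (Real.exp_pos _).le hbase _).trans hg
    have hqq : Real.exp (-(s * (2 * κ * Real.log n))) ≤ interProb n k ^ s.choose 2 := by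
      rw [h.iP, h.q_exp, ← Real.exp_nat_mul, Nat.cast_choose_two]
      apply Real.exp_le_exp.2
      have ha := h.a_hi
      have ha0 := h.a0
      have hs1 : (1:ℝ) ≤ s := by exact_mod_cast hs0
      have : (s:ℝ)*(s-1)/2 * Real.log (1/qf n k) ≤ s * s/2 * (κ^2 * Real.log n) := by
        apply mul_le_mul _ ha ha0.le (by positivity)
        nlinarith
      have h3 : (s:ℝ) * s/2 * (κ^2 * Real.log n) = (s * κ * Real.log n) * (κ * s) /2 := by ring
      have h4 : (s * κ * Real.log n) * (κ * s) ≤ (s * κ * Real.log n) * 3 := by gcongr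
      have h5 : 0 ≤ s * κ * Real.log n := by positivity
      linarith
    have : 1 ≤ Lam n k p s := by
      unfold Lam
      refine le_trans ?_ (mul_le_mul hg2 hqq (Real.exp_pos _).le (le_trans (Real.exp_pos _).le hg2))
      rw [← Real.exp_add]
      apply Real.one_le_exp
      have : 0 ≤ s * Real.log n := by positivity
      nlinarith
    linarith)
  have bD := pow_lower_aux hφ0 D hD0 (L := Real.log n) (by rw [← h.nexp]; exact kD)
  refine le_trans (Real.exp_le_exp.2 ?_) bD
  apply neg_le_neg
  have hD0' : (0:ℝ) < D := by exact_mod_cast hD0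
  rw [div_le_iff₀ hD0']
  rw [div_le_iff₀ hκ] at hD1
  nlinarith

lemma mu_lo (h : Env ε κ n k) {p : ℝ} (hφ : Real.exp (-(κ * Real.log n)) ≤ phi n k p) :
    Real.exp ((1/2 - 2*κ) * Real.log n) ≤ mubar n k p := by
  have e : mubar n k p = phi n k p * (n/k) := by unfold mubar; ring
  rw [e]
  refine le_trans ?_ (mul_le_mul hφ h.nk_ge (Real.exp_pos _).le (le_trans (Real.exp_pos _).le hφ))
  rw [← Real.exp_add]
  apply Real.exp_le_exp.2
  linarith

lemma mu_hi (h : Env ε κ n k) {p : ℝ} (hφ : phi n k p ≤ phiStar n k) :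
    mubar n k p ≤ n / 2 := by
  have e : mubar n k p = phi n k p * (n/k) := by unfold mubar; ring
  rw [e]
  rw [h.phiS] at hφ
  have hkp := h.kpos
  have hn := h.npos
  have hL := h.L1
  have h1 : Real.log n ^ 3 / Real.log (1/qf n k) ≤ Real.exp (κ * Real.log n)/2 * Real.exp ((1/4-ε/2) * Real.log n) := by
    rw [div_eq_mul_one_div]
    have := h.pw 2 3 (by norm_num) (by norm_num)
    apply mul_le_mul (by linarith) h.ainv (by have := h.a0; positivity) (by positivity)
  have h2 := mul_le_mul (hφ.trans h1) h.nk_le (by positivity) (by positivity)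
  refine h2.trans ?_
  conv_rhs => rw [h.nexp]
  rw [div_mul_eq_mul_div, div_mul_eq_mul_div]
  apply div_le_div_of_nonneg_right _ (by norm_num)
  rw [← Real.exp_add, ← Real.exp_add]
  apply Real.exp_le_exp.2
  have := h.kap.2
  have := h.hε0
  nlinarith
end Env

/-- threshold -/
noncomputable def Tt (n k g : ℕ) : ℝ := 2 * (g:ℝ)^2 * (k:ℝ)^2 / n + 3 * lamP n k * g * Real.log n

namespace Env
variable {ε κ : ℝ} {n k : ℕ}

lemma T_nonneg (h : Env ε κ n k) (g : ℕ) : 0 ≤ Tt n k g := by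
  unfold Tt
  have := h.lam0; have := h.L1; have := h.npos
  positivity

lemma a_le (h : Env ε κ n k) : Real.log (1/qf n k) ≤ Real.log n := by
  have := h.a_hi; have := h.kap.2; have := h.L1; have := h.hκ0
  have : κ^2 ≤ 1 := by nlinarith
  nlinarith

lemma T_hi (h : Env ε κ n k) (g : ℕ) (hg : (g:ℝ) ≤ Real.log n ^ 3 / Real.log (1/qf n k)) :
    Tt n k g + 1 ≤ 6 * Real.log n ^ 7 / Real.log (1/qf n k)^2 := by
  set L := Real.log n with hL
  set a := Real.log (1/qf n k) with ha
  have ha0 : 0 < a := h.a0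
  have hL1 : 10^6 ≤ L := h.L1
  have haL : a ≤ L := h.a_le
  have hx : (k:ℝ)^2/n ≤ L := h.x_hi
  have hlam : lamP n k ≤ L / a := h.lam_hi2
  have hn := h.npos
  have t1 : 2 * (g:ℝ)^2 * (k:ℝ)^2 / n ≤ 2 * (L^3/a)^2 * L := by
    rw [mul_div_assoc]
    gcongr
  have t2 : 3 * lamP n k * g * L ≤ 3 * (L/a) * (L^3/a) * L := by
    have := h.lam0
    gcongr
  have e1 : 2 * (L^3/a)^2 * L = 2 * (L^7/a^2) := by field_simp
  have e2 : 3 * (L/a) * (L^3/a) * L = 3 * (L^5/a^2) := by field_simp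
  have t3 : L^5/a^2 ≤ L^7/a^2 := by
    apply div_le_div_of_nonneg_right _ (by positivity)
    apply pow_le_pow_right₀ (by linarith) (by norm_num)
  have t4 : 1 ≤ L^7/a^2 := by
    rw [le_div_iff₀ (by positivity), one_mul]
    calc a^2 ≤ L^2 := by gcongr
      _ ≤ L^7 := pow_le_pow_right₀ (by linarith) (by norm_num)
  have e3 : 6 * L^7/a^2 = 6 * (L^7/a^2) := by ring
  unfold Tt
  rw [e3, ← hL]
  linarith

lemma T_small (h : Env ε κ n k) (g : ℕ) (hg : (g:ℝ) ≤ Real.log n ^ 3 / Real.log (1/qf n k)) :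
    2 * (Tt n k g + 1 + k) ≤ n := by
  have h1 := h.T_hi g hg
  have hL := h.L1
  have hκ := h.kap.2
  have hκ2 := h.kap.1
  have hε := h.hε0
  have h6 : (6:ℝ) * k ≤ n := by exact_mod_cast h.kn6
  have h2 : 6 * Real.log n ^ 7 / Real.log (1/qf n k)^2 ≤ n / 4 := by
    have e : 6 * Real.log n ^ 7 / Real.log (1/qf n k)^2 = 6 * Real.log n^7 * (1/Real.log (1/qf n k))^2 := by ring
    rw [e]
    have := h.pw 24 7 (by norm_num) (by norm_num)
    have h3 : (1/Real.log (1/qf n k))^2 ≤ Real.exp ((1/4-ε/2) * Real.log n)^2 := by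
      have := h.a0
      gcongr
      exact h.ainv
    have h4 := mul_le_mul this h3 (by positivity) (Real.exp_pos _).le
    rw [← Real.exp_nat_mul, ← Real.exp_add] at h4
    have h5 : Real.exp (κ * Real.log n + (2:ℕ) * ((1/4-ε/2) * Real.log n)) ≤ n := by
      conv_rhs => rw [h.nexp]
      apply Real.exp_le_exp.2
      push_cast
      nlinarith
    linarith
  linarith

set_option maxHeartbeats 2000000 in
lemma eE_small (h : Env ε κ n k) (g : ℕ) (hg : (g:ℝ) ≤ Real.log n ^ 3 / Real.log (1/qf n k)) :
    g * eE n k g (Tt n k g) (lamP n k) ≤ 1 := by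
  have hT := h.T_hi g hg
  have hT0 := h.T_nonneg g
  have hxh := h.x_hi
  have hai := h.ainv
  have hkn := h.kn_le
  have hlh := h.lam_hi
  have hqlo := h.q_lo
  have pw1 := h.pw 48 14 (by norm_num) (by norm_num)
  have pw2 := h.pw 48 10 (by norm_num) (by norm_num)
  unfold eE
  have hκ := h.kap.2
  have hκ2 := h.kap.1
  have hκ0 := h.hκ0
  have hε := h.hε0
  have hq0 := h.q0
  have hn := h.npos
  have hne := h.nexp
  have ha0 : 0 < Real.log (1/qf n k) := h.a0
  have hL1 : 10^6 ≤ Real.log n := h.L1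
  set L := Real.log n with hL
  set a := Real.log (1/qf n k) with ha
  set q := qf n k with hq
  set T := Tt n k g with hTd
  set N : ℝ := (n:ℝ) with hN
  clear_value L a q T N
  have hg0 : (0:ℝ) ≤ g := by positivity
  have hqi : 1/q ≤ Real.exp (κ * L) := by
    rw [one_div, inv_le_comm₀ hq0 (Real.exp_pos _), ← Real.exp_neg]
    refine le_trans (Real.exp_le_exp.2 ?_) hqlo
    nlinarith [mul_pos hκ0 (show 0 < L by linarith)]
  have t1 : g * (g*(4*a*(k:ℝ)^2*(T+1)/(q*N^2))) ≤ 1/2 := by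
    have e : g * (g*(4*a*(k:ℝ)^2*(T+1)/(q*N^2))) = (g:ℝ)^2 * (4*a) * ((k:ℝ)^2/N) * (T+1) * (1/q) * (1/N) := by
      field_simp
    rw [e]
    have s1 : (g:ℝ)^2 * (4*a) * ((k:ℝ)^2/N) * (T+1) * (1/q) * (1/N) ≤
      (L^3/a)^2 * (4*a) * L * (6*L^7/a^2) * Real.exp (κ*L) * (1/N) := by
      gcongr
    have e2 : (L^3/a)^2 * (4*a) * L * (6*L^7/a^2) * Real.exp (κ*L) * (1/N) = (24 * L^14) * (1/a)^3 * Real.exp (κ*L) * (1/N) := by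
      field_simp; ring
    rw [e2] at s1
    have s2 : (24 * L^14) * (1/a)^3 * Real.exp (κ*L) * (1/N) ≤ (Real.exp (κ*L)/2) * Real.exp ((1/4-ε/2) * L)^3 * Real.exp (κ*L) * (1/N) := by
      gcongr
      linarith
    have s3 : (Real.exp (κ*L)/2) * Real.exp ((1/4-ε/2) * L)^3 * Real.exp (κ*L) * (1/N) = 1/2 * Real.exp (κ*L + 3*((1/4-ε/2)*L) + κ*L - L) := by
      rw [hne, Real.exp_sub, Real.exp_add, Real.exp_add, show (3:ℝ) = ((3:ℕ):ℝ) by norm_num, Real.exp_nat_mul]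
      ring
    have s4 : Real.exp (κ*L + 3*((1/4-ε/2)*L) + κ*L - L) ≤ 1 := by
      apply Real.exp_le_one_iff.2
      nlinarith
    linarith
  have t2 : g * (k/N*(a*Real.exp (a*lamP n k)*(2*T))) ≤ 1/2 := by
    have s1 : g * (k/N*(a*Real.exp (a*lamP n k)*(2*T))) ≤ (L^3/a) * (Real.exp (-(1/2-κ)*L) * (a * Real.exp (2*κ*L) * (2 * (6*L^7/a^2)))) := by
      gcongr
      linarith
    have e2 : (L^3/a) * (Real.exp (-(1/2-κ)*L) * (a * Real.exp (2*κ*L) * (2 * (6*L^7/a^2)))) = (12 * L^10) * (1/a)^2 * Real.exp (2*κ*L) * Real.exp (-(1/2-κ)*L) := by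
      field_simp; ring
    rw [e2] at s1
    have s2 : (12 * L^10) * (1/a)^2 * Real.exp (2*κ*L) * Real.exp (-(1/2-κ)*L) ≤ (Real.exp (κ*L)/2) * Real.exp ((1/4-ε/2) * L)^2 * Real.exp (2*κ*L) * Real.exp (-(1/2-κ)*L) := by
      gcongr
      have : 0 ≤ L^10 := by positivity
      linarith
    have s3 : (Real.exp (κ*L)/2) * Real.exp ((1/4-ε/2) * L)^2 * Real.exp (2*κ*L) * Real.exp (-(1/2-κ)*L) = 1/2 * Real.exp (κ*L + 2*((1/4-ε/2)*L) + 2*κ*L + -(1/2-κ)*L) := by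
      rw [Real.exp_add, Real.exp_add, Real.exp_add, show 2*((1/4-ε/2)*L) = ((2:ℕ):ℝ) *((1/4-ε/2)*L) by norm_num, Real.exp_nat_mul]
      ring
    have s4 : Real.exp (κ*L + 2*((1/4-ε/2)*L) + 2*κ*L + -(1/2-κ)*L) ≤ 1 := by
      apply Real.exp_le_one_iff.2
      nlinarith
    linarith
  rw [mul_add]
  linarith

lemma err_term (h : Env ε κ n k) (g m : ℕ) (hg : 1 ≤ g) (hm : (m:ℝ) ≤ n) :
    n * (Real.exp (-(1/lamP n k * Tt n k g)) * Real.exp (2 * (1/lamP n k) * k ^ 2 * g / n) ^ g) * (m.choose g : ℝ)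
      ≤ Real.exp (-Real.log n) := by
  have hl := h.lam0
  have hn := h.npos
  have hL := h.L1
  have e : Real.exp (-(1/lamP n k * Tt n k g)) * Real.exp (2 * (1/lamP n k) * k ^ 2 * g / n) ^ g = Real.exp (-(3 * g * Real.log n)) := by
    rw [← Real.exp_nat_mul, ← Real.exp_add]
    congr 1
    unfold Tt
    field_simp
    ring
  rw [e]
  have h1 : (m.choose g : ℝ) ≤ Real.exp (g * Real.log n) := by
    rw [Real.exp_nat_mul, ← h.nexp]
    have : (m.choose g : ℝ) ≤ (m:ℝ)^g := by exact_mod_cast Nat.choose_le_pow m g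
    exact this.trans (pow_le_pow_left₀ (by positivity) hm g)
  refine le_trans (mul_le_mul_of_nonneg_left h1 (by positivity)) ?_
  conv_lhs => rw [h.nexp]
  rw [← Real.exp_add, ← Real.exp_add, Real.log_exp]
  apply Real.exp_le_exp.2
  have : (1:ℝ) ≤ g := by exact_mod_cast hg
  nlinarith

lemma m_le (h : Env ε κ n k) {p : ℝ} (hφ : Real.exp (-(κ * Real.log n)) ≤ phi n k p) (m : ℕ)
    (hm : |(m:ℝ) - mubar n k p| < Real.sqrt (mubar n k p) * Real.log n) : (m:ℝ) ≤ 2 * mubar n k p := by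
  have h1 := h.mu_lo hφ
  have hL := h.L1
  have hκ := h.kap.2
  set μ := mubar n k p
  have hμ0 : 0 < μ := lt_of_lt_of_le (Real.exp_pos _) h1
  have h2 : Real.log n ^ 2 ≤ μ := by
    have := h.pw 1 2 (by norm_num) (by norm_num)
    refine le_trans (by linarith) (le_trans (Real.exp_le_exp.2 ?_) h1)
    nlinarith
  have h3 : Real.log n ≤ Real.sqrt μ := Real.le_sqrt_of_sq_le h2
  have h4 : Real.sqrt μ * Real.log n ≤ μ := by
    calc Real.sqrt μ * Real.log n ≤ Real.sqrt μ * Real.sqrt μ := by gcongr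
      _ = μ := Real.mul_self_sqrt hμ0.le
  have := (abs_lt.1 hm).2
  linarith
end Env

lemma choose_le_exp (m g : ℕ) (hg : 1 ≤ g) (y : ℝ) (hy : (m:ℝ) ≤ g * Real.exp y) :
    (m.choose g : ℝ) ≤ Real.exp (g * (y + 1)) := by
  have h1 : (m.choose g : ℝ) ≤ (m:ℝ)^g / g.factorial := Nat.choose_le_pow_div g m
  have h2 : (g:ℝ)^g / g.factorial ≤ Real.exp g := Real.pow_div_factorial_le_exp g (by positivity) g
  have h3 : (m:ℝ)^g ≤ (g * Real.exp y)^g := pow_le_pow_left₀ (by positivity) hy g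
  calc (m.choose g : ℝ) ≤ (m:ℝ)^g / g.factorial := h1
    _ ≤ (g * Real.exp y)^g / g.factorial := by gcongr
    _ = (g:ℝ)^g / g.factorial * Real.exp y ^ g := by rw [mul_pow]; ring
    _ ≤ Real.exp g * Real.exp y ^ g := by gcongr
    _ = _ := by rw [← Real.exp_nat_mul, ← Real.exp_add]; congr 1; ring

lemma arithA {ε κ L a G D : ℝ} (hε0 : 0 < ε) (hκ0 : 0 < κ) (hκ1 : κ ≤ ε^2/64) (hκ : κ ≤ 1/1024)
    (hκ2 : κ ≤ ε/256) (hL : 10^6 ≤ L) (ha0 : 0 < a) (hκL : 100 ≤ κ^2 * L) (haκ : a ≤ κ^2 * L)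
    (hg0 : 0 < G) (hd0 : 0 ≤ D) (hd : D < (1-ε) * G) (hA : (1+ε/2) * L ≤ a * G) :
    G * ((1/2+2*κ) * L + 1) + (-(a * (G * (G-1)/2)) +
      (L + (G + D * (-(1/2-κ) * L) + a * (D * (D-1)/2)))) + L ≤ -L := by
  have hL0 : 0 < L := by linarith
  have b1 : L - a * (G + D - 1) ≤ -(ε/4) * L := by
    have h1 : 0 ≤ a * D := by positivity
    have h2 : κ^2 ≤ ε/4 := by nlinarith
    have h3 : κ^2 * L ≤ ε/4 * L := by gcongr
    linarith
  have hGD : D ≤ G := by nlinarith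
  have b2 : (G - D)/2 * (L - a * (G + D - 1)) ≤ (G - D)/2 * (-(ε/4) * L) := by
    apply mul_le_mul_of_nonneg_left b1
    linarith
  have b3 : (G - D)/2 * (-(ε/4) * L) ≤ (ε * G)/2 * (-(ε/4) * L) := by
    apply mul_le_mul_of_nonpos_right
    · linarith
    · have : 0 < ε/4*L := by positivity
      linarith
  have hGL : 0 < G * L := by positivity
  have b4 : κ * (G * L) ≤ ε^2/64 * (G * L) := by
    apply mul_le_mul_of_nonneg_right hκ1 hGL.le
  have b5 : 2 * G ≤ κ * (G * L) := by
    have h1 : κ^2 * L ≤ 1 * (κ * L) := by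
      rw [show κ^2 * L = κ * (κ * L) by ring]
      gcongr
      linarith
    have : 2 * G ≤ (κ * L) * G := by
      apply mul_le_mul_of_nonneg_right _ hg0.le
      linarith
    linarith
  have b6 : 3 * L ≤ κ * (G * L) := by
    have b7 : 1 * L ≤ (κ^2 * G) * L := by
      have h1 : a * G ≤ κ^2 * L * G := by gcongr
      have h2 : 0 ≤ ε/2*L := by positivity
      linarith
    have b8 : 1 ≤ κ^2 * G := le_of_mul_le_mul_right b7 hL0
    have h4 : κ * (κ * G) ≤ (1/1024) * (κ * G) := by gcongr
    have b9 : 3 ≤ κ * G := by linarith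
    have : 3 * L ≤ (κ * G) * L := by gcongr
    linarith
  have b9 : κ * (D * L) ≤ κ * (G * L) := by gcongr
  have b10 : 0 < ε^2 * (G * L) := by positivity
  linarith

namespace Env
variable {ε κ : ℝ} {n k : ℕ}

lemma g_hi (h : Env ε κ n k) (g : ℕ) (hg : (g:ℝ) ≤ Real.log n ^ 3 / Real.log (1/qf n k)) :
    (g:ℝ) + 1 ≤ Real.exp ((1/4 - ε/2 + κ) * Real.log n) := by
  have hL := h.L1
  have h1 := h.ainv
  have h2 := h.pw 2 3 (by norm_num) (by norm_num)
  have hA : 1 ≤ Real.exp ((1/4-ε/2) * Real.log n) := by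
    apply Real.one_le_exp
    have := h.hε1
    nlinarith
  set A := Real.exp ((1/4-ε/2) * Real.log n) with hAd
  have hL3 : 1 ≤ Real.log n ^ 3 := one_le_pow₀ (by linarith)
  have h3 : Real.log n ^ 3 / Real.log (1/qf n k) ≤ Real.log n ^ 3 * A := by
    rw [div_eq_mul_one_div]; gcongr
  have e : Real.exp ((1/4 - ε/2 + κ) * Real.log n) = Real.exp (κ * Real.log n) * A := by
    rw [hAd, ← Real.exp_add]; congr 1; ring
  rw [e]
  calc (g:ℝ) + 1 ≤ Real.log n ^ 3 * A + Real.log n ^ 3 * A := by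
        apply add_le_add (hg.trans h3)
        nlinarith
    _ = 2 * Real.log n ^ 3 * A := by ring
    _ ≤ _ := by gcongr

lemma q_pow (h : Env ε κ n k) (g : ℕ) :
    qf n k ^ (g.choose 2) = Real.exp (-(Real.log (1/qf n k) * (g * (g-1)/2))) := by
  conv_lhs => rw [h.q_exp, ← Real.exp_nat_mul, Nat.cast_choose_two]
  congr 1; ring

lemma caseA (h : Env ε κ n k) {p : ℝ} (g d m : ℕ) (hd : (d:ℝ) < (1-ε) * g)
    (hg : (g:ℝ) ≤ Real.log n ^ 3 / Real.log (1/qf n k))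
    (hA : (1+ε/2) * Real.log n ≤ Real.log (1/qf n k) * g)
    (hm : (m:ℝ) ≤ 2 * mubar n k p) (hφ0 : 0 ≤ phi n k p) (hφ : phi n k p ≤ phiStar n k) :
    (m.choose g : ℝ) * (qf n k ^ (g.choose 2) * (n * bterm n k g d)) * (g+1) ≤ Real.exp (-Real.log n) := by
  have hL := h.L1
  have ha0 := h.a0
  have hκ0 := h.hκ0
  have hε0 := h.hε0
  have hε1 := h.hε1
  have hκL := h.Lκ
  have haκ := h.a_hi
  have hkn := h.kn_le
  have hkp := h.kpos
  have hn := h.npos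
  have hκ := h.kap.2
  have hg0 : (0:ℝ) < g := by
    by_contra hc
    have : (g:ℝ) = 0 := le_antisymm (not_lt.1 hc) (by positivity)
    rw [this] at hA
    nlinarith
  have hg1 : 1 ≤ g := by exact_mod_cast hg0
  -- binomial
  have c1 : (m.choose g : ℝ) ≤ Real.exp (g * ((1/2+2*κ) * Real.log n + 1)) := by
    apply choose_le_exp m g hg1
    refine hm.trans ?_
    have e : mubar n k p = phi n k p * (n/k) := by unfold mubar; ring
    rw [e]
    have h1 : phi n k p ≤ g * Real.log n ^ 2 := by
      refine hφ.trans ?_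
      rw [h.phiS, div_le_iff₀ ha0]
      have : Real.log n ≤ Real.log (1/qf n k) * g := by nlinarith
      calc Real.log n ^ 3 = Real.log n ^ 2 * Real.log n := by ring
        _ ≤ Real.log n ^ 2 * (Real.log (1/qf n k) * g) := by gcongr
        _ = _ := by ring
    have h2 := h.pw 2 2 (by norm_num) (by norm_num)
    calc 2 * (phi n k p * (n/k)) ≤ 2 * (g * Real.log n ^ 2 * Real.exp ((1/2+κ) * Real.log n)) := by
          have := h.nk_le
          gcongr
      _ = g * (2 * Real.log n ^ 2 * Real.exp ((1/2+κ) * Real.log n)) := by ring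
      _ ≤ g * (Real.exp (κ * Real.log n) * Real.exp ((1/2+κ) * Real.log n)) := by gcongr
      _ = _ := by rw [← Real.exp_add]; congr 2; ring
  have c3 : bterm n k g d ≤ Real.exp (g + d * (-(1/2-κ) * Real.log n) + Real.log (1/qf n k) * (d * (d-1)/2)) := by
    unfold bterm
    rw [h.q_pow d, div_eq_mul_inv, ← Real.exp_neg, neg_neg, Real.exp_add, Real.exp_add]
    gcongr
    · have h1 : (g.choose d : ℝ) ≤ (2:ℝ)^g := by
        exact_mod_cast Nat.choose_le_two_pow g d
      refine h1.trans ?_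
      have : (2:ℝ) ≤ Real.exp 1 := by linarith [Real.add_one_le_exp (1:ℝ)]
      calc (2:ℝ)^g ≤ Real.exp 1 ^ g := by gcongr
        _ = _ := by rw [← Real.exp_nat_mul, mul_one]
    · rw [Real.exp_nat_mul]
      gcongr
  have c4 : (g:ℝ) + 1 ≤ Real.exp (Real.log n) := by
    refine (h.g_hi g hg).trans (Real.exp_le_exp.2 ?_)
    nlinarith
  have hb := bterm_nonneg n k g d
  have hq0 := h.q0
  calc (m.choose g : ℝ) * (qf n k ^ (g.choose 2) * (n * bterm n k g d)) * (g+1)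
      ≤ Real.exp (g * ((1/2+2*κ) * Real.log n + 1)) * (Real.exp (-(Real.log (1/qf n k) * (g * (g-1)/2))) *
        (Real.exp (Real.log n) * Real.exp (g + d * (-(1/2-κ) * Real.log n) + Real.log (1/qf n k) * (d * (d-1)/2)))) * Real.exp (Real.log n) := by
        rw [h.q_pow g, ← h.nexp]
        rw [← h.nexp] at c4
        gcongr
    _ ≤ Real.exp (-Real.log n) := by
        rw [← Real.exp_add, ← Real.exp_add, ← Real.exp_add, ← Real.exp_add]
        apply Real.exp_le_exp.2
        exact arithA hε0 hκ0 h.hκ1 hκ h.kap.1 hL ha0 hκL haκ hg0 (by positivity) hd hA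
end Env

lemma gchoose_nonneg (x : ℝ) (t : ℕ) (ht : (t:ℝ) ≤ x + 1) : 0 ≤ gchoose x t := by
  unfold gchoose
  apply div_nonneg _ (by positivity)
  apply Finset.prod_nonneg
  intro i hi
  have : ((i+1:ℕ):ℝ) ≤ t := by exact_mod_cast Finset.mem_range.1 hi
  push_cast at this
  linarith

lemma gchoose_succ (x : ℝ) (t : ℕ) : gchoose x (t+1) = gchoose x t * ((x - t)/(t+1)) := by
  unfold gchoose
  rw [Finset.prod_range_succ, Nat.factorial_succ]
  push_cast
  field_simp

lemma Lam_desc (x q σ : ℝ) (hq0 : 0 < q) (hq1 : q ≤ 1) (hσ : σ < 1) (s t : ℕ) (hst : s ≤ t) (ht : (t:ℝ) ≤ x)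
    (hs : gchoose x s * q ^ s.choose 2 ≤ σ) : gchoose x t * q ^ t.choose 2 ≤ σ := by
  set F : ℕ → ℝ := fun j => gchoose x j * q ^ j.choose 2 with hF
  have hsucc : ∀ j, F (j+1) = F j * ((x - j)/(j+1) * q^j) := by
    intro j
    simp only [hF]
    rw [gchoose_succ, Nat.choose_succ_succ' j 1, pow_add]
    simp
    ring
  have hF0 : ∀ j : ℕ, j ≤ t → 0 ≤ F j := by
    intro j hj
    have : (j:ℝ) ≤ t := by exact_mod_cast hj
    exact mul_nonneg (gchoose_nonneg x j (by linarith)) (by positivity)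
  obtain ⟨i, his, hi⟩ : ∃ i < s, (x - i)/(i+1) * q^i < 1 := by
    by_contra hc
    push Not at hc
    have : ∀ j ≤ s, 1 ≤ F j := by
      intro j
      induction j with
      | zero => intro _; simp [hF, gchoose]
      | succ j ih =>
        intro hj
        rw [hsucc]
        have h1 := ih (by omega)
        have h2 := hc j (by omega)
        nlinarith
    have := this s le_rfl
    have h2 : F s ≤ σ := hs
    linarith
  have hstep : ∀ j, s ≤ j → j ≤ t → F j ≤ σ := by
    intro j hsj
    induction j, hsj using Nat.le_induction with
    | base => intro _; exact hs
    | succ j hj ih =>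
      intro hjt
      rw [hsucc]
      have h1 := ih (by omega)
      have h0 := hF0 j (by omega)
      have hr : (x - j)/(j+1) * q^j ≤ 1 := by
        refine le_trans ?_ hi.le
        have hij : (i:ℝ) ≤ j := by exact_mod_cast (by omega : i ≤ j)
        have hjx : (j:ℝ) ≤ x := le_trans (by exact_mod_cast (by omega : j ≤ t)) ht
        have hi0 : (0:ℝ) ≤ i := by positivity
        have e : q^j ≤ q^i := pow_le_pow_of_le_one hq0.le hq1 (by omega)
        have e2 : (x - j)/((j:ℝ)+1) ≤ (x-i)/(i+1) := by
          apply div_le_div₀ <;> linarith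
        apply mul_le_mul e2 e (by positivity)
        apply div_nonneg <;> linarith
      nlinarith
  exact hstep t hst le_rfl

lemma choose_gchoose (m g : ℕ) (μ L : ℝ) (hμ : 0 < μ) (hL : 0 ≤ L) (hm : (m:ℝ) ≤ μ + Real.sqrt μ * L) (hg : (g:ℝ) ≤ μ/2)
    (hgL : g * (2 * L) ≤ Real.sqrt μ) : (m.choose g : ℝ) ≤ 3 * gchoose μ g := by
  have hs0 : 0 < Real.sqrt μ := Real.sqrt_pos.2 hμ
  have hss : Real.sqrt μ * Real.sqrt μ = μ := Real.mul_self_sqrt hμ.le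
  set r := 1 + 2 * L / Real.sqrt μ with hr
  have hr0 : 0 < r := by positivity
  have e : (m.choose g : ℝ) = (∏ i ∈ Finset.range g, ((m - i : ℕ):ℝ)) / g.factorial := by
    rw [Nat.choose_eq_descFactorial_div_factorial, Nat.cast_div (Nat.factorial_dvd_descFactorial m g) (by positivity),
      Nat.descFactorial_eq_prod_range]
    push_cast
    rfl
  have h1 : ∏ i ∈ Finset.range g, ((m - i : ℕ):ℝ) ≤ ∏ i ∈ Finset.range g, (r * (μ - i)) := by
    apply Finset.prod_le_prod
    · intro i _; positivity
    · intro i hi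
      have hig : (i:ℝ) < g := by exact_mod_cast Finset.mem_range.1 hi
      have hpos : 0 < μ - i := by linarith
      by_cases him : i ≤ m
      · rw [Nat.cast_sub him, hr]
        have : Real.sqrt μ * L ≤ 2 * L / Real.sqrt μ * (μ - i) := by
          rw [div_mul_eq_mul_div, le_div_iff₀ hs0]
          have : Real.sqrt μ * L * Real.sqrt μ = μ * L := by rw [mul_right_comm, hss]
          rw [this]
          nlinarith
        linarith
      · rw [Nat.sub_eq_zero_of_le (by omega)]
        push_cast
        positivity
  have h2 : r ^ g ≤ 3 := by
    have : r ≤ Real.exp (2*L/Real.sqrt μ) := by rw [hr, add_comm]; exact Real.add_one_le_exp _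
    calc r^g ≤ Real.exp (2*L/Real.sqrt μ)^g := by gcongr
      _ = Real.exp (g * (2*L/Real.sqrt μ)) := by rw [← Real.exp_nat_mul]
      _ ≤ Real.exp 1 := by
        apply Real.exp_le_exp.2
        rw [← mul_div_assoc, div_le_one hs0]
        exact hgL
      _ ≤ 3 := by linarith [Real.exp_one_lt_d9]
  have hg0 : 0 ≤ gchoose μ g := gchoose_nonneg μ g (by linarith)
  rw [Finset.prod_mul_distrib, Finset.prod_const, Finset.card_range] at h1
  calc (m.choose g : ℝ) ≤ (r ^ g * ∏ i ∈ Finset.range g, (μ - i)) / g.factorial := by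
        rw [e]; gcongr
    _ = r^g * gchoose μ g := by unfold gchoose; ring
    _ ≤ _ := by gcongr

namespace Env
variable {ε κ : ℝ} {n k : ℕ}

lemma b_small (h : Env ε κ n k) (g d : ℕ) (hg : (g:ℝ) ≤ Real.log n ^ 3 / Real.log (1/qf n k))
    (hd : (d:ℝ) ≤ lamP n k) : bterm n k g d ≤ (1/2)^d := by
  have hL := h.L1
  have ha0 := h.a0
  have hκ := h.kap.2
  have hε0 := h.hε0
  have hgh := h.g_hi g hg
  have hd0 : (0:ℝ) ≤ d := by positivity
  have hn := h.npos
  have h1 : (g.choose d : ℝ) ≤ Real.exp ((1/4 - ε/2 + κ) * Real.log n)^d := by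
    have : (g.choose d : ℝ) ≤ (g:ℝ)^d := by exact_mod_cast Nat.choose_le_pow g d
    refine this.trans ?_
    gcongr
    linarith
  have h2 : ((k:ℝ)/n)^d ≤ Real.exp (-(1/2-κ) * Real.log n)^d := by
    have := h.kn_le
    gcongr
  have h3 : Real.exp (Real.log (1/qf n k) * (d * (d-1)/2)) ≤ Real.exp (2 * κ * Real.log n)^d := by
    rw [← Real.exp_nat_mul]
    apply Real.exp_le_exp.2
    have h4 := h.lam_hi
    have h5 : Real.log (1/qf n k) * d ≤ Real.log (1/qf n k) * lamP n k := by gcongr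
    have h6 : d * (Real.log (1/qf n k) * d) ≤ d * (2 * κ * Real.log n) := by
      apply mul_le_mul_of_nonneg_left _ hd0; linarith
    have h7 : 0 ≤ Real.log (1/qf n k) * d := by positivity
    have h8 : 0 ≤ d * (Real.log (1/qf n k) * d) := by positivity
    linarith
  unfold bterm
  rw [h.q_pow d, div_eq_mul_inv, ← Real.exp_neg, neg_neg]
  calc (g.choose d : ℝ) * ((k:ℝ)/n)^d * Real.exp (Real.log (1/qf n k) * (d * (d-1)/2))
      ≤ Real.exp ((1/4 - ε/2 + κ) * Real.log n)^d * Real.exp (-(1/2-κ) * Real.log n)^d * Real.exp (2 * κ * Real.log n)^d := by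
        gcongr
    _ = (Real.exp ((1/4 - ε/2 + κ) * Real.log n + -(1/2-κ) * Real.log n + 2 * κ * Real.log n))^d := by
        rw [Real.exp_add, Real.exp_add, mul_pow, mul_pow]
    _ ≤ (1/2)^d := by
        gcongr
        refine le_trans (Real.exp_le_exp.2 ?_) Real.exp_neg_one_lt_half.le
        nlinarith

lemma b_large (h : Env ε κ n k) (g d : ℕ) (hd : lamP n k < (d:ℝ)) (hdt : (d:ℝ) < (1-ε) * g)
    (hB : Real.log (1/qf n k) * g ≤ (1+ε/2) * Real.log n) : n * bterm n k g d ≤ Real.exp (-Real.log n) := by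
  have hL := h.L1
  have ha0 := h.a0
  have hκ := h.kap.2
  have hκ2 := h.kap.1
  have hκ0 := h.hκ0
  have hε0 := h.hε0
  have hε1 := h.hε1
  have hn := h.npos
  have hl0 := h.lam0
  have hllo := h.lam_lo
  have hκL := h.Lκ
  have hd0 : (0:ℝ) < d := by linarith
  have hd1 : 1 ≤ d := by exact_mod_cast hd0
  have hp := h.pw 2 1 (by norm_num) (by norm_num)
  have hgd : (g:ℝ) ≤ d * Real.exp (κ * Real.log n) := by
    have h1 := h.lam_lo2
    have h2 : 1 ≤ Real.sqrt (Real.log n) := Real.one_le_sqrt.2 (by linarith)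
    have h3 : 1 ≤ Real.log (1/qf n k) * lamP n k := h2.trans h1
    have hg0 : (0:ℝ) ≤ g := by positivity
    have h4 : (g:ℝ) * 1 ≤ g * (Real.log (1/qf n k) * lamP n k) := by gcongr
    have h5 : (Real.log (1/qf n k) * g) * lamP n k ≤ ((1+ε/2) * Real.log n) * lamP n k := by gcongr
    have h6 : ((1+ε/2) * Real.log n) * lamP n k ≤ (2 * Real.log n) * d := by
      gcongr
      linarith
    have h7 : (2 * Real.log n) * d ≤ Real.exp (κ * Real.log n) * d := by
      gcongr
      simpa using hp
    linarith
  have h1 : (g.choose d : ℝ) ≤ Real.exp (d * (κ * Real.log n + 1)) := choose_le_exp g d hd1 _ hgd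
  have h2 : ((k:ℝ)/n)^d ≤ Real.exp (d * (-(1/2-κ) * Real.log n)) := by
    rw [Real.exp_nat_mul]
    have := h.kn_le
    gcongr
  have h3 : Real.exp (Real.log (1/qf n k) * (d * (d-1)/2)) ≤ Real.exp (d * ((1/2-ε/4) * Real.log n)) := by
    apply Real.exp_le_exp.2
    have h5 : Real.log (1/qf n k) * d ≤ Real.log (1/qf n k) * ((1-ε) * g) := by gcongr
    have h6 : (1-ε) * (Real.log (1/qf n k) * g) ≤ (1-ε) * ((1+ε/2) * Real.log n) := by
      apply mul_le_mul_of_nonneg_left hB; linarith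
    have h7 : (1-ε) * ((1+ε/2) * Real.log n) ≤ (1 - ε/2) * Real.log n := by
      have : 0 ≤ ε^2/2 * Real.log n := by positivity
      linarith
    have h8 : d * (Real.log (1/qf n k) * d) ≤ d * ((1-ε/2) * Real.log n) := by
      apply mul_le_mul_of_nonneg_left _ hd0.le; linarith
    have h9 : 0 ≤ Real.log (1/qf n k) * d := by positivity
    linarith
  unfold bterm
  rw [h.q_pow d, div_eq_mul_inv, ← Real.exp_neg, neg_neg]
  calc (n:ℝ) * ((g.choose d : ℝ) * ((k:ℝ)/n)^d * Real.exp (Real.log (1/qf n k) * (d * (d-1)/2)))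
      ≤ n * (Real.exp (d * (κ * Real.log n + 1)) * Real.exp (d * (-(1/2-κ) * Real.log n)) * Real.exp (d * ((1/2-ε/4) * Real.log n))) := by
        gcongr
    _ = Real.exp (Real.log n + d * (κ * Real.log n + 1 + -(1/2-κ) * Real.log n + (1/2-ε/4) * Real.log n)) := by
        conv_lhs => rw [h.nexp]
        rw [Real.log_exp, ← Real.exp_add, ← Real.exp_add, ← Real.exp_add]
        congr 1; ring
    _ ≤ _ := by
        apply Real.exp_le_exp.2
        set L := Real.log n
        have hL0 : 0 < L := by linarith
        have c1 : 1 ≤ κ * L := by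
          have : κ^2 * L ≤ 1 * (κ * L) := by
            rw [show κ^2 * L = κ * (κ * L) by ring]
            gcongr
            linarith
          linarith
        have c2 : κ * L ≤ ε/256 * L := by gcongr
        have c3 : κ * L + 1 + -(1/2-κ) * L + (1/2-ε/4) * L ≤ -(ε/8) * L := by
          have : 0 ≤ ε * L := by positivity
          linarith
        have c4 : d * (κ * L + 1 + -(1/2-κ) * L + (1/2-ε/4) * L) ≤ d * (-(ε/8) * L) := by gcongr
        have c5 : 2/κ * (ε/8 * L) ≤ d * (ε/8 * L) := by
          gcongr
          linarith
        have c6 : 64 ≤ 2/κ * (ε/8) := by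
          rw [div_mul_eq_mul_div, le_div_iff₀ hκ0]
          linarith
        have c7 : 64 * L ≤ (2/κ * (ε/8)) * L := by gcongr
        linarith

lemma sumB (h : Env ε κ n k) (g : ℕ) (hg : (g:ℝ) ≤ Real.log n ^ 3 / Real.log (1/qf n k))
    (hB : Real.log (1/qf n k) * g ≤ (1+ε/2) * Real.log n) :
    ∑ d ∈ (Finset.range (g+1)).filter (fun d : ℕ => (d:ℝ) < (1-ε)*g),
          (if (d:ℝ) ≤ lamP n k then 1 else (n:ℝ)) * bterm n k g d ≤ 3 := by
  have hL := h.L1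
  have hκ := h.kap.2
  have hε0 := h.hε0
  calc _ ≤ ∑ d ∈ (Finset.range (g+1)).filter (fun d : ℕ => (d:ℝ) < (1-ε)*g), (((1:ℝ)/2)^d + Real.exp (-Real.log n)) := by
        apply Finset.sum_le_sum
        intro d hd
        rw [Finset.mem_filter] at hd
        have he := Real.exp_pos (-Real.log n)
        split_ifs with hl
        · have := h.b_small g d hg hl
          linarith
        · have := h.b_large g d (not_le.1 hl) hd.2 hB
          have : (0:ℝ) < (1/2)^d := by positivity
          linarith
    _ ≤ ∑ d ∈ Finset.range (g+1), (((1:ℝ)/2)^d + Real.exp (-Real.log n)) := by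
        apply Finset.sum_le_sum_of_subset_of_nonneg (Finset.filter_subset _ _)
        intro d _ _
        positivity
    _ = ∑ d ∈ Finset.range (g+1), ((1:ℝ)/2)^d + (g+1) * Real.exp (-Real.log n) := by
        rw [Finset.sum_add_distrib, Finset.sum_const, Finset.card_range, nsmul_eq_mul]
        push_cast; rfl
    _ ≤ 2 + 1 := by
        apply add_le_add
        · exact sum_geometric_two_le _
        · have := h.g_hi g hg
          calc ((g:ℝ)+1) * Real.exp (-Real.log n) ≤ Real.exp ((1/4 - ε/2 + κ) * Real.log n) * Real.exp (-Real.log n) := by gcongr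
            _ ≤ 1 := by
              rw [← Real.exp_add]
              apply Real.exp_le_one_iff.2
              nlinarith
    _ = 3 := by norm_num

lemma caseB_choose (h : Env ε κ n k) {p : ℝ} (g m : ℕ) (hφ : Real.exp (-(κ * Real.log n)) ≤ phi n k p)
    (hm : |(m:ℝ) - mubar n k p| < Real.sqrt (mubar n k p) * Real.log n)
    (hg : (g:ℝ) ≤ Real.log n ^ 3 / Real.log (1/qf n k)) :
    (g:ℝ) ≤ mubar n k p / 2 ∧ (m.choose g : ℝ) ≤ 3 * gchoose (mubar n k p) g := by
  have hL := h.L1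
  have hκ := h.kap.2
  have hκ2 := h.kap.1
  have hε0 := h.hε0
  have hμ := h.mu_lo hφ
  have hgh := h.g_hi g hg
  have hp := h.pw 2 1 (by norm_num) (by norm_num)
  set μ := mubar n k p
  have hμ0 : 0 < μ := lt_of_lt_of_le (Real.exp_pos _) hμ
  have hsq : Real.exp ((1/4 - κ) * Real.log n) ≤ Real.sqrt μ := by
    apply Real.le_sqrt_of_sq_le
    rw [← Real.exp_nat_mul]
    refine le_trans (Real.exp_le_exp.2 ?_) hμ
    push_cast; linarith
  have hgL : g * (2 * Real.log n) ≤ Real.sqrt μ := by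
    refine le_trans ?_ hsq
    calc g * (2 * Real.log n) ≤ Real.exp ((1/4 - ε/2 + κ) * Real.log n) * Real.exp (κ * Real.log n) := by
          rw [pow_one] at hp
          apply mul_le_mul _ hp (by positivity) (by positivity)
          linarith
      _ ≤ _ := by
          rw [← Real.exp_add]
          apply Real.exp_le_exp.2
          nlinarith
  have hss : Real.sqrt μ * Real.sqrt μ = μ := Real.mul_self_sqrt hμ0.le
  have hs1 : 1 ≤ Real.sqrt μ := by
    refine le_trans (Real.one_le_exp ?_) hsq
    nlinarith
  have hgμ : (g:ℝ) ≤ μ/2 := by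
    have hg0 : (0:ℝ) ≤ g := by positivity
    nlinarith
  refine ⟨hgμ, ?_⟩
  apply choose_gchoose m g μ (Real.log n) hμ0 (by linarith) _ hgμ hgL
  have := (abs_lt.1 hm).2
  linarith
end Env

namespace Env
variable {ε κ : ℝ} {n k : ℕ}

lemma final_aux (h : Env ε κ n k) (g m : ℕ) (S B : ℝ) (hg1 : 1 ≤ g)
    (hg : (g:ℝ) ≤ Real.log n ^ 3 / Real.log (1/qf n k)) (hm : (m:ℝ) ≤ n)
    (hS : ∑ d ∈ (Finset.range (g+1)).filter (fun d : ℕ => (d:ℝ) < (1-ε)*g),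
          (if (d:ℝ) ≤ lamP n k then 1 else (n:ℝ)) * bterm n k g d = S)
    (hB : (m.choose g : ℝ) * (qf n k ^ (g.choose 2) * S) ≤ B) (hB0 : 0 ≤ B) :
    tupleProb n k g (fun f =>
        (∀ i j, i ≠ j → (f i ∩ f j).Nonempty) ∧
        (∀ v w : Fin n, lamP n k < (tdeg f v : ℝ) →
          lamP n k < (tdeg f w : ℝ) → v = w) ∧
        (∀ v : Fin n, (tdeg f v : ℝ) < (1-ε)*g)) * (m.choose g : ℝ) ≤
      Real.exp (-Real.log n) + 3 * B := by
  have hl := h.lam0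
  have hn := h.npos
  have hk6 := h.kn6
  have hmc := main_comb k g (Tt n k g) (lamP n k) (1/lamP n k) ((1-ε)*g)
    (by exact_mod_cast hn)
    (by omega)
    (h.T_small g hg) h.q0 h.q1 (by positivity) (by rw [one_div_mul_cancel hl.ne'])
  have hee : Real.exp (eE n k g (Tt n k g) (lamP n k)) ^ g ≤ 3 := by
    rw [← Real.exp_nat_mul]
    have := Real.exp_le_exp.2 (h.eE_small g hg)
    linarith [Real.exp_one_lt_d9]
  have herr := h.err_term g m hg1 hm
  rw [hS] at hmc
  refine le_trans (mul_le_mul_of_nonneg_right hmc (by positivity)) ?_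
  rw [add_mul]
  refine add_le_add herr ?_
  calc _ = Real.exp (eE n k g (Tt n k g) (lamP n k)) ^ g *
        ((m.choose g : ℝ) * (qf n k ^ (g.choose 2) * S)) := by ring
    _ ≤ Real.exp (eE n k g (Tt n k g) (lamP n k)) ^ g * B := by gcongr
    _ ≤ 3 * B := by gcongr

lemma final_bound (h : Env ε κ n k) {p σ υ : ℝ} (m : ℕ) (h0 : 0 ≤ p) (h1 : p ≤ 1) (hσ : σ < 1/12)
    (hυ : υ ≤ Real.exp (-6)) (hLam : hprob n k p (fun H => σ < Lam n k p (maxDegree H)) < υ)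
    (hφ : phi n k p ≤ phiStar n k)
    (hm : |(m:ℝ) - mubar n k p| < Real.sqrt (mubar n k p) * Real.log n) :
    tupleProb n k (gammaP n k p σ) (fun f =>
        (∀ i j, i ≠ j → (f i ∩ f j).Nonempty) ∧
        (∀ v w : Fin n, lamP n k < (tdeg f v : ℝ) →
          lamP n k < (tdeg f w : ℝ) → v = w) ∧
        (∀ v : Fin n, (tdeg f v : ℝ) < tauP ε n k p σ)) * (m.choose (gammaP n k p σ) : ℝ) ≤
      4 * Real.exp (-Real.log n) + 27 * |σ| := by
  have hφl := h.phi_lo h0 h1 hσ hυ hLam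
  have hφ0 := phi_nonneg' (n := n) (k := k) h0
  have hm2 := h.m_le hφl m hm
  have hmh := h.mu_hi hφ
  have hL := h.L1
  have ha0 := h.a0
  have hale := h.a_le
  have hε0 := h.hε0
  have hε1 := h.hε1
  have hn := h.npos
  have hn1 : (1:ℝ) ≤ n := by
    rw [h.nexp]; exact Real.one_le_exp (by linarith)
  have hps := h.phiS
  have hps0 : 0 ≤ phiStar n k / 3 := by rw [hps]; positivity
  unfold tauP
  have hgdef : gammaP n k p σ = min (alphaP n k p σ) ⌊phiStar n k / 3⌋₊ := rfl
  set g := gammaP n k p σ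
  have hg : (g:ℝ) ≤ Real.log n ^ 3 / Real.log (1/qf n k) := by
    have h3 : (g:ℝ) ≤ (⌊phiStar n k / 3⌋₊ : ℝ) := by
      exact_mod_cast hgdef ▸ min_le_right _ _
    have h4 := Nat.floor_le hps0
    rw [← hps]; linarith
  have hexp := Real.exp_pos (-Real.log n)
  have hσa := le_abs_self σ
  have hσ0 := abs_nonneg σ
  have hq0 := h.q0
  rcases le_total ((1+ε/2) * Real.log n) (Real.log (1/qf n k) * g) with hA | hB
  · have hg1 : 1 ≤ g := by
      rcases Nat.eq_zero_or_pos g with h5 | h5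
      · rw [h5] at hA; norm_num at hA; nlinarith
      · exact h5
    refine le_trans (h.final_aux g m _ (Real.exp (-Real.log n)) hg1 hg (by linarith) rfl ?_ hexp.le) (by linarith)
    set D := (Finset.range (g+1)).filter (fun d : ℕ => (d:ℝ) < (1-ε)*g)
    have hcard : (D.card : ℝ) ≤ g + 1 := by
      have := Finset.card_filter_le (Finset.range (g+1)) (fun d : ℕ => (d:ℝ) < (1-ε)*g)
      rw [Finset.card_range] at this
      exact_mod_cast this
    rw [Finset.mul_sum, Finset.mul_sum]
    calc _ ≤ ∑ d ∈ D, Real.exp (-Real.log n) / (g+1) := by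
          apply Finset.sum_le_sum
          intro d hd
          rw [le_div_iff₀ (by positivity)]
          refine le_trans ?_ (h.caseA g d m (Finset.mem_filter.1 hd).2 hg hA hm2 hφ0 hφ)
          have := bterm_nonneg n k g d
          gcongr
          split_ifs
          · exact hn1
          · exact le_refl _
      _ = D.card * (Real.exp (-Real.log n) / (g+1)) := by rw [Finset.sum_const, nsmul_eq_mul]
      _ ≤ (g+1) * (Real.exp (-Real.log n) / (g+1)) := by gcongr
      _ = _ := by field_simp
  · obtain ⟨hgμ, hch⟩ := h.caseB_choose g m hφl hm hg
    have hgal : g = alphaP n k p σ := by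
      rcases min_choice (alphaP n k p σ) ⌊phiStar n k / 3⌋₊ with h5 | h5
      · rw [hgdef, h5]
      · exfalso
        rw [hgdef, h5] at hB
        have h6 := Nat.lt_floor_add_one (phiStar n k / 3)
        have h7 : Real.log (1/qf n k) * (phiStar n k / 3) = Real.log n ^ 3 / 3 := by
          rw [hps]; field_simp
        have h8 := mul_lt_mul_of_pos_left h6 ha0
        rw [h7] at h8
        nlinarith [mul_pos (show (0:ℝ) < Real.log n by linarith) (show (0:ℝ) < Real.log n by linarith)]
    have hα : alpha2 n k p σ ≤ g := by rw [hgal]; exact le_max_right _ _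
    have hΛ := exists_Lam σ υ h0 h1 hLam (le_trans hυ (by rw [Real.exp_le_one_iff]; norm_num))
    have hμ0 : 0 ≤ mubar n k p := by
      unfold mubar; positivity
    have hg1 : 1 ≤ g := by
      by_contra hc
      have h5 : alpha2 n k p σ = 0 := by omega
      rw [h5, Lam_zero] at hΛ
      linarith
    unfold Lam at hΛ
    rw [h.iP] at hΛ
    have hΛg := Lam_desc (mubar n k p) (qf n k) σ hq0 h.q1.le (by linarith) _ g hα (by linarith) hΛ
    have hS := h.sumB g hg hB
    refine le_trans (h.final_aux g m _ (9 * |σ|) hg1 hg (by linarith) rfl ?_ (by positivity)) (by linarith)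
    have hgc := gchoose_nonneg (mubar n k p) g (by linarith)
    calc _ ≤ (3 * gchoose (mubar n k p) g) * (qf n k ^ (g.choose 2) * 3) := by
          have hS0 : 0 ≤ ∑ d ∈ (Finset.range (g+1)).filter (fun d : ℕ => (d:ℝ) < (1-ε)*g),
              (if (d:ℝ) ≤ lamP n k then 1 else (n:ℝ)) * bterm n k g d := by
            apply Finset.sum_nonneg
            intro d _
            apply mul_nonneg _ (bterm_nonneg n k g d)
            split_ifs <;> linarith
          apply mul_le_mul hch _ (by positivity) (by positivity)
          gcongr
      _ = 9 * (gchoose (mubar n k p) g * qf n k ^ (g.choose 2)) := by ring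
      _ ≤ _ := by linarith
end Env

lemma ev_hP (κ : ℝ) (hκ : 0 < κ) : ∀ᶠ n : ℕ in atTop,
    10^6 * Real.log n ^ 20 ≤ Real.exp (κ * Real.log n) := by
  have h1 := (isLittleO_pow_exp_pos_mul_atTop 20 hκ).bound (c := 1/10^6) (by norm_num)
  have h2 := (Real.tendsto_log_atTop.comp tendsto_natCast_atTop_atTop).eventually h1
  filter_upwards [h2] with n hn
  simp only [Function.comp, norm_pow, Real.norm_eq_abs, Real.abs_exp] at hn
  have h3 : |Real.log (n:ℝ)| ^ 20 = Real.log n ^ 20 := by rw [Even.pow_abs (by decide)]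
  rw [h3] at hn
  linarith

/-- **Lemma C′.** Under the standing assumptions: if `A_1, …, A_γ` are drawn uniformly and
independently from the `k`-subsets of `[n]` and `Q` is the event that `{A_1,…,A_γ}` is a
clique with at most one vertex of degree greater than `λ` and none of degree `≥ τ`, then
for any `m` with `|m - μ̄| < √μ̄ · log n` one has `Pr(Q) = o(C(m,γ)⁻¹)`. -/
theorem generic_clique_tuple_bound
    (ε : ℝ) (hε0 : 0 < ε) (hε14 : ε < 1 / 4)
    (k : ℕ → ℕ) (p : ℕ → ℝ)
    (hp0 : ∀ n, 0 ≤ p n) (hp1 : ∀ n, p n ≤ 1)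
    (hnk : ∀ᶠ n in atTop, 2 * k n < n)
    (δ : ℕ → ℝ) (hδ : Tendsto δ atTop (nhds 0))
    (hklow : ∀ᶠ n : ℕ in atTop, (n : ℝ) ^ ((1 : ℝ) / 2 - δ n) < (k n : ℝ))
    (hkup : ∀ᶠ n in atTop, (k n : ℝ) < Real.sqrt ((1 / 4 - ε) * n * Real.log n))
    (σ υ : ℕ → ℝ) (hσ : Tendsto σ atTop (nhds 0)) (hυ : Tendsto υ atTop (nhds 0))
    (hLam : ∀ᶠ n in atTop,
      hprob n (k n) (p n) (fun H => σ n < Lam n (k n) (p n) (maxDegree H)) < υ n)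
    (hφ : ∀ᶠ n in atTop, phi n (k n) (p n) ≤ phiStar n (k n))
    (m : ℕ → ℕ)
    (hm : ∀ᶠ n in atTop,
      |(m n : ℝ) - mubar n (k n) (p n)| < Real.sqrt (mubar n (k n) (p n)) * Real.log n) :
    Tendsto (fun n =>
      tupleProb n (k n) (gammaP n (k n) (p n) (σ n)) (fun f =>
        (∀ i j, i ≠ j → (f i ∩ f j).Nonempty) ∧
        (∀ v w : Fin n, lamP n (k n) < (tdeg f v : ℝ) →
          lamP n (k n) < (tdeg f w : ℝ) → v = w) ∧
        (∀ v : Fin n, (tdeg f v : ℝ) < tauP ε n (k n) (p n) (σ n))) *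
      ((m n).choose (gammaP n (k n) (p n) (σ n)) : ℝ)) atTop (nhds 0) := by
  have hlog : Tendsto (fun n : ℕ => Real.log (n:ℝ)) atTop atTop :=
    Real.tendsto_log_atTop.comp tendsto_natCast_atTop_atTop
  obtain ⟨κ, hκdef⟩ : ∃ κ : ℝ, κ = ε^2/64 := ⟨_, rfl⟩
  have hκ0 : 0 < κ := by rw [hκdef]; positivity
  have hlim : Tendsto (fun n : ℕ => 4 * Real.exp (-Real.log (n:ℝ)) + 27 * |σ n|) atTop (nhds 0) := by
    have h1 := (Real.tendsto_exp_neg_atTop_nhds_zero.comp hlog).const_mul 4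
    have h2 := hσ.abs.const_mul 27
    have h3 := h1.add h2
    simp only [abs_zero, mul_zero, add_zero] at h3
    exact h3
  refine squeeze_zero' ?_ ?_ hlim
  · filter_upwards with n
    unfold tupleProb uprob
    positivity
  · filter_upwards [hlog.eventually_ge_atTop (100/κ^2), ev_hP κ hκ0, hklow, hkup, hLam, hφ, hm,
      hδ.eventually_le_const (show (0:ℝ) < κ^2/4 by positivity),
      hσ.eventually_lt_const (show (0:ℝ) < 1/12 by norm_num),
      hυ.eventually_le_const (Real.exp_pos (-6))] with n e1 e2 e3 e4 e5 e6 e7 e8 e9 e10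
    have hL0 : 0 < Real.log (n:ℝ) := lt_of_lt_of_le (by positivity) e1
    have hn : (0:ℝ) < n := by
      rcases Nat.eq_zero_or_pos n with h | h
      · rw [h] at hL0; simp at hL0
      · exact_mod_cast h
    have hE : Env ε κ n (k n) := by
      refine ⟨hε0, hε14, hκ0, hκdef.le, e1, e2, ?_, ?_⟩
      · refine le_trans ?_ e3.le
        rw [Real.rpow_def_of_pos hn]
        apply Real.exp_le_exp.2
        nlinarith
      · exact ((Real.lt_sqrt (by positivity)).1 e4).le
    exact hE.final_bound (m n) (hp0 n) (hp1 n) e9 e10 e5 e6 e7
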